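/- arXiv:1203.5020 — 16 statements merged into one kernel-verified Lean document; each statement's English description precedes it below -/
import Mathlib

section
/- Fix u ∈ ℝ with χ(u)² + αu(1−u) > 0 and let T > 0 be such that f_t(u) > 0 for all t ∈ [0,T]. Then the function ψ(t) := u(u−1)·sinh(γ(u)t/2)/(γ(u)·f_t(u)) satisfies ψ(0) = 0 and, for every t ∈ [0,T], ψ is differentiable at t with derivative ψ'(t) = (1/2)u(u−1) + (α/2)ψ(t)² + uρ√α·ψ(t) + β·ψ(t); i.e. ψ solves the Riccati equation ∂_tψ = R(u,ψ) with R(u,w) = (1/2)u(u−1) + (α/2)w² + uρ√α·w + βw and ψ(0)=0. -/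
open Real Set

/-- the function ψ solves the Riccati equation ∂ₜψ = R(u, ψ), ψ(0) = 0,
on the interval [0, T] on which f_t(u) > 0. -/
theorem riccati_solution
    (a b α β ρ v : ℝ) (ha : 0 ≤ a) (hb : 0 ≤ b) (hα : 0 < α) (hρ : |ρ| ≤ 1) (hv : 0 < v)
    (χ γ : ℝ → ℝ) (f : ℝ → ℝ → ℝ)
    (hχ : ∀ u, χ u = β + u * ρ * Real.sqrt α)
    (hγ : ∀ u, γ u = Real.sqrt (χ u ^ 2 + α * u * (1 - u)))
    (hf : ∀ t u, f t u = Real.cosh (γ u * t / 2) - (χ u / γ u) * Real.sinh (γ u * t / 2))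
    (u : ℝ) (hu : χ u ^ 2 + α * u * (1 - u) > 0)
    (T : ℝ) (hT : 0 < T) (hfpos : ∀ t ∈ Set.Icc (0 : ℝ) T, f t u > 0)
    (ψ : ℝ → ℝ)
    (hψ : ∀ t, ψ t = u * (u - 1) * Real.sinh (γ u * t / 2) / (γ u * f t u)) :
    ψ 0 = 0 ∧
      ∀ t ∈ Set.Icc (0 : ℝ) T,
        HasDerivAt ψ
          ((1 / 2) * u * (u - 1) + (α / 2) * (ψ t) ^ 2
            + u * ρ * Real.sqrt α * ψ t + β * ψ t) t := by
  have hγpos : 0 < γ u := by rw [hγ]; exact Real.sqrt_pos.mpr hu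
  have hγsq : γ u ^ 2 = χ u ^ 2 + α * u * (1 - u) := by rw [hγ]; exact Real.sq_sqrt hu.le
  have hχu := hχ u
  have hden : ∀ t, γ u * f t u =
      γ u * Real.cosh (γ u * t / 2) - χ u * Real.sinh (γ u * t / 2) := by
    intro t
    rw [hf]
    field_simp
  refine ⟨by simp [hψ], fun t ht => ?_⟩
  have hDpos : 0 < γ u * f t u := mul_pos hγpos (hfpos t ht)
  have hψ_eq : ψ = fun s => u * (u - 1) * Real.sinh (γ u * s / 2) /
      (γ u * Real.cosh (γ u * s / 2) - χ u * Real.sinh (γ u * s / 2)) := by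
    funext s
    rw [hψ, hden]
  rw [hden] at hDpos
  have harg : HasDerivAt (fun s : ℝ => γ u * s / 2) (γ u / 2) t := by
    simpa using ((hasDerivAt_id t).const_mul (γ u)).div_const 2
  have hderiv := (harg.sinh.const_mul (u * (u - 1))).fun_div
    ((harg.cosh.const_mul (γ u)).fun_sub (harg.sinh.const_mul (χ u))) hDpos.ne'
  rw [hψ_eq]
  refine hderiv.congr_deriv ?_
  beta_reduce
  generalize Real.cosh (γ u * t / 2) = C at *
  generalize Real.sinh (γ u * t / 2) = S at *
  have hD := hDpos.ne'
  generalize hDdef : γ u * C - χ u * S = D at hD ⊢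
  have hR : (1 / 2) * u * (u - 1) + (α / 2) * (u * (u - 1) * S / D) ^ 2
      + u * ρ * Real.sqrt α * (u * (u - 1) * S / D) + β * (u * (u - 1) * S / D)
      = (u * (u - 1) / 2) * (D ^ 2 + α * (u * (u - 1)) * S ^ 2 + 2 * χ u * S * D) / D ^ 2 := by
    rw [hχu]
    field_simp
    ring
  rw [hR]
  congr 1
  subst hDdef
  linear_combination -(u * (u - 1) / 2) * S ^ 2 * hγsq
end

section
/- Assume |ρ| < 1, χ(0) ≤ 0 and χ(1) ≤ 0. Then for every u ∈ (u_−, u_+) and every t ≥ 0, f_t(u) > 0. -/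
open Real Set

/-- Factorization of `u ↦ χ(u)² + αu(1 - u)`, with `s = √α`, through the roots given by the
quadratic formula. -/
lemma discriminant_eq_mul_roots {s β ρ d um up : ℝ} (hs : s ≠ 0) (hρ : 1 - ρ ^ 2 ≠ 0)
    (hd : d ^ 2 = (2 * β * ρ + s) ^ 2 + 4 * β ^ 2 * (1 - ρ ^ 2))
    (hum : um = (2 * β * ρ + s - d) / (2 * s * (1 - ρ ^ 2)))
    (hup : up = (2 * β * ρ + s + d) / (2 * s * (1 - ρ ^ 2))) (u : ℝ) :
    (β + u * ρ * s) ^ 2 + s ^ 2 * u * (1 - u) =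
      s ^ 2 * (1 - ρ ^ 2) * ((u - um) * (up - u)) := by
  have hsum : s * (1 - ρ ^ 2) * (um + up) = 2 * β * ρ + s := by
    rw [hum, hup]; field_simp; ring
  have hprod : s ^ 2 * (1 - ρ ^ 2) * (um * up) = -β ^ 2 := by
    rw [hum, hup]; field_simp; linear_combination -hd
  linear_combination (-(s * u)) * hsum + hprod

/-- if |ρ| < 1, χ(0) ≤ 0 and χ(1) ≤ 0, then f_t(u) > 0
for all u ∈ (u₋, u₊) and t ≥ 0. -/
theorem f_pos_case_i_a
    (a b α β ρ v : ℝ) (ha : 0 ≤ a) (hb : 0 ≤ b) (hα : 0 < α) (hρ : |ρ| < 1) (hv : 0 < v)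
    (χ γ : ℝ → ℝ) (f : ℝ → ℝ → ℝ) (um up : ℝ)
    (hχ : ∀ u, χ u = β + u * ρ * Real.sqrt α)
    (hγ : ∀ u, γ u = Real.sqrt (χ u ^ 2 + α * u * (1 - u)))
    (hf : ∀ t u, f t u = Real.cosh (γ u * t / 2) - (χ u / γ u) * Real.sinh (γ u * t / 2))
    (hum : um = (2 * β * ρ + Real.sqrt α
        - Real.sqrt ((2 * β * ρ + Real.sqrt α) ^ 2 + 4 * β ^ 2 * (1 - ρ ^ 2)))
        / (2 * Real.sqrt α * (1 - ρ ^ 2)))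
    (hup : up = (2 * β * ρ + Real.sqrt α
        + Real.sqrt ((2 * β * ρ + Real.sqrt α) ^ 2 + 4 * β ^ 2 * (1 - ρ ^ 2)))
        / (2 * Real.sqrt α * (1 - ρ ^ 2)))
    (hχ0 : χ 0 ≤ 0) (hχ1 : χ 1 ≤ 0) :
    ∀ u ∈ Set.Ioo um up, ∀ t : ℝ, 0 ≤ t → 0 < f t u := by
  intro u hu t ht
  have hs : 0 < √α := Real.sqrt_pos.2 hα
  have hs2 : √α ^ 2 = α := Real.sq_sqrt hα.le
  have hρ' : 0 < 1 - ρ ^ 2 := by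
    linarith [(sq_lt_one_iff_abs_lt_one ρ).2 hρ]
  have hq (w : ℝ) : χ w ^ 2 + α * w * (1 - w) = α * (1 - ρ ^ 2) * ((w - um) * (up - w)) := by
    have h := discriminant_eq_mul_roots hs.ne' hρ'.ne'
      (Real.sq_sqrt (by positivity)) hum hup w
    rwa [hs2, ← hχ] at h
  have hc : 0 < α * (1 - ρ ^ 2) := mul_pos hα hρ'
  have hlt : um < up := hu.1.trans hu.2
  have hmem {w : ℝ} (hw : w * (1 - w) = 0) : um ≤ w ∧ w ≤ up := by
    have h1 : 0 ≤ (w - um) * (up - w) := by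
      refine nonneg_of_mul_nonneg_right ?_ hc
      rw [← hq, mul_assoc, hw]
      positivity
    constructor <;> by_contra! h <;> nlinarith
  have h0 := hmem (w := 0) (by norm_num)
  have h1 := hmem (w := 1) (by norm_num)
  have hroot {w : ℝ} (hwm : um < w) (hwp : w < up) (hw : w * (1 - w) ≤ 0) : χ w ≠ 0 := by
    intro hχw
    have h : 0 < α * (1 - ρ ^ 2) * ((w - um) * (up - w)) :=
      mul_pos hc (mul_pos (sub_pos.2 hwm) (sub_pos.2 hwp))
    rw [← hq, hχw] at h
    nlinarith
  have hcont : Continuous χ := by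
    rw [funext hχ]
    fun_prop
  have hχu : χ u ≤ 0 := by
    by_contra! hpos
    rcases lt_or_ge u 0 with hu0 | hu0
    · obtain ⟨w, hw, hχw⟩ :=
        intermediate_value_Icc' hu0.le hcont.continuousOn ⟨hχ0, hpos.le⟩
      exact hroot (hu.1.trans_le hw.1) (by linarith [hw.2]) (by nlinarith [hw.2]) hχw
    rcases lt_or_ge 1 u with hu1 | hu1
    · obtain ⟨w, hw, hχw⟩ :=
        intermediate_value_Icc hu1.le hcont.continuousOn ⟨hχ1, hpos.le⟩
      exact hroot (by linarith [hw.1]) (hw.2.trans_lt hu.2) (by nlinarith [hw.1]) hχw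
    · have hconv : χ u = (1 - u) * χ 0 + u * χ 1 := by
        simp only [hχ]
        ring
      nlinarith
  have hγu : 0 ≤ γ u := hγ u ▸ Real.sqrt_nonneg _
  have hsinh : 0 ≤ Real.sinh (γ u * t / 2) := Real.sinh_nonneg_iff.2 (by positivity)
  rw [hf]
  linarith [Real.cosh_pos (γ u * t / 2),
    mul_nonpos_of_nonpos_of_nonneg (div_nonpos_of_nonpos_of_nonneg hχu hγu) hsinh]
end

section
/- Assume |ρ| < 1 and χ(1) > 0. Then u_+ > 1, and for every u ∈ (1, u_+): one has 0 < γ(u) < χ(u); for every t > 0, f_t(u) = 0 if and only if t = F(u), where F(u) := (2/γ(u))·artanh(γ(u)/χ(u)); and F(u) → +∞ as u decreases to 1. -/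
open Real Set Filter Topology

/-- For `0 < g < x`, the function `s ↦ cosh s - (x / g) sinh s` vanishes exactly at
`s = artanh (g / x)`. -/
lemma cosh_sub_div_mul_sinh_eq_zero_iff {g x : ℝ} (hg : 0 < g) (hgx : g < x) (s : ℝ) :
    Real.cosh s - (x / g) * Real.sinh s = 0 ↔ s = Real.artanh (g / x) := by
  have hx : 0 < x := hg.trans hgx
  have hmem : g / x ∈ Set.Ioo (-1 : ℝ) 1 :=
    ⟨by linarith [div_pos hg hx], (div_lt_one hx).2 hgx⟩
  have hc : 0 < Real.cosh s := Real.cosh_pos s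
  have htanh : Real.cosh s - (x / g) * Real.sinh s = 0 ↔ Real.tanh s = g / x := by
    rw [Real.tanh_eq_sinh_div_cosh, div_eq_div_iff hc.ne' hx.ne', sub_eq_zero, div_mul_eq_mul_div,
      eq_div_iff hg.ne']
    constructor <;> intro h <;> linarith
  rw [htanh]
  constructor
  · intro h
    rw [← h, Real.artanh_tanh]
  · rintro rfl
    exact Real.tanh_artanh hmem

/-- `log ((1 + r) / (1 - r))` tends to `+∞` as `r` increases to `1`. -/
lemma tendsto_log_one_add_div_one_sub_atTop :
    Tendsto (fun r : ℝ => Real.log ((1 + r) / (1 - r))) (𝓝[<] 1) atTop := by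
  refine Real.tendsto_log_atTop.comp ?_
  have hnum : Tendsto (fun r : ℝ => 1 + r) (𝓝[<] 1) (𝓝 (1 + 1)) :=
    (Continuous.tendsto (by fun_prop) 1).mono_left nhdsWithin_le_nhds
  have hden : Tendsto (fun r : ℝ => 1 - r) (𝓝[<] 1) (𝓝[>] 0) := by
    refine tendsto_nhdsWithin_iff.2 ⟨?_, ?_⟩
    · have h : Tendsto (fun r : ℝ => 1 - r) (𝓝 1) (𝓝 (1 - 1)) :=
        Continuous.tendsto (by fun_prop) 1
      rw [sub_self] at h
      exact h.mono_left nhdsWithin_le_nhds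
    · filter_upwards [self_mem_nhdsWithin] with r hr
      exact sub_pos.2 (Set.mem_Iio.1 hr)
  simpa only [div_eq_mul_inv, Function.comp_apply] using
    hnum.pos_mul_atTop (by norm_num) (tendsto_inv_nhdsGT_zero.comp hden)

/-- If the affine function `x u = β + u m` is positive at `1`, and the quadratic
`x u ^ 2 + α u (1 - u)` is positive on `(1, w)`, then `x` is positive on `(1, w)`. -/
lemma affine_pos_of_quadratic_pos {α β m w : ℝ} (hα : 0 < α) (h1 : 0 < β + 1 * m)
    (hQ : ∀ u ∈ Set.Ioo 1 w, 0 < (β + u * m) ^ 2 + α * u * (1 - u)) {u : ℝ}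
    (hu : u ∈ Set.Ioo 1 w) : 0 < β + u * m := by
  by_contra! hneg
  have hcont : ContinuousOn (fun y : ℝ => β + y * m) (Set.Icc 1 u) := by fun_prop
  obtain ⟨y, hy, hy0⟩ := intermediate_value_Icc' hu.1.le hcont ⟨hneg, h1.le⟩
  have hy1 : 1 < y := by
    refine lt_of_le_of_ne hy.1 ?_
    rintro rfl
    exact h1.ne' hy0
  have h := hQ y ⟨hy1, hy.2.trans_lt hu.2⟩
  simp only at hy0
  rw [hy0] at h
  nlinarith [mul_pos (mul_pos hα (by linarith : 0 < y)) (sub_pos.2 hy1)]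

/-- If the quadratic `β² + s B u - c s² u²` is positive at `1`, its larger root exceeds `1`, and it
is positive between `1` and that root. -/
lemma one_lt_root_and_quadratic_pos {s B β c : ℝ} (hs : 0 < s) (hc : 0 < c)
    (h1 : 0 < β ^ 2 + s * B - c * s ^ 2) :
    1 < (B + Real.sqrt (B ^ 2 + 4 * β ^ 2 * c)) / (2 * s * c) ∧
      ∀ u ∈ Set.Ioo 1 ((B + Real.sqrt (B ^ 2 + 4 * β ^ 2 * c)) / (2 * s * c)),
        0 < β ^ 2 + s * B * u - c * s ^ 2 * u ^ 2 := by
  have hsc : 0 < 2 * s * c := by positivity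
  have hR : Real.sqrt (B ^ 2 + 4 * β ^ 2 * c) ^ 2 = B ^ 2 + 4 * β ^ 2 * c :=
    Real.sq_sqrt (by positivity)
  have hR0 : 0 ≤ Real.sqrt (B ^ 2 + 4 * β ^ 2 * c) := Real.sqrt_nonneg _
  set R := Real.sqrt (B ^ 2 + 4 * β ^ 2 * c)
  obtain ⟨hl, hr⟩ := abs_lt_of_sq_lt_sq' (a := 2 * s * c - B)
    (by nlinarith [mul_pos hc h1]) hR0
  refine ⟨(one_lt_div hsc).2 (by linarith), fun u hu => ?_⟩
  have hu2 : u * (2 * s * c) < B + R := (lt_div_iff₀ hsc).1 hu.2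
  have hu1 : 2 * s * c < u * (2 * s * c) := lt_mul_of_one_lt_left hsc hu.1
  have hprod : 0 < (B + R - u * (2 * s * c)) * (u * (2 * s * c) - B + R) :=
    mul_pos (by linarith) (by linarith)
  have hmul : 0 < 4 * c * (β ^ 2 + s * B * u - c * s ^ 2 * u ^ 2) := by
    convert hprod using 1
    linear_combination -hR
  exact pos_of_mul_pos_right hmul (by positivity)

/-- if |ρ| < 1 and χ(1) > 0 then u₊ > 1, and on (1, u₊) one has
0 < γ(u) < χ(u), the zeros of t ↦ f_t(u) on (0,∞) are exactly t = F(u) with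
F(u) = (2/γ(u))·artanh(γ(u)/χ(u)), and F(u) → ∞ as u ↓ 1. -/
theorem explosion_time_case_i_b
    (a b α β ρ v : ℝ) (ha : 0 ≤ a) (hb : 0 ≤ b) (hα : 0 < α) (hρ : |ρ| < 1) (hv : 0 < v)
    (χ γ : ℝ → ℝ) (f : ℝ → ℝ → ℝ) (um up : ℝ) (F : ℝ → ℝ)
    (hχ : ∀ u, χ u = β + u * ρ * Real.sqrt α)
    (hγ : ∀ u, γ u = Real.sqrt (χ u ^ 2 + α * u * (1 - u)))
    (hf : ∀ t u, f t u = Real.cosh (γ u * t / 2) - (χ u / γ u) * Real.sinh (γ u * t / 2))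
    (hum : um = (2 * β * ρ + Real.sqrt α
        - Real.sqrt ((2 * β * ρ + Real.sqrt α) ^ 2 + 4 * β ^ 2 * (1 - ρ ^ 2)))
        / (2 * Real.sqrt α * (1 - ρ ^ 2)))
    (hup : up = (2 * β * ρ + Real.sqrt α
        + Real.sqrt ((2 * β * ρ + Real.sqrt α) ^ 2 + 4 * β ^ 2 * (1 - ρ ^ 2)))
        / (2 * Real.sqrt α * (1 - ρ ^ 2)))
    (hF : ∀ u, F u = (2 / γ u) * ((1 / 2) * Real.log ((1 + γ u / χ u) / (1 - γ u / χ u))))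
    (hχ1 : 0 < χ 1) :
    1 < up ∧
      (∀ u ∈ Set.Ioo (1 : ℝ) up,
        (0 < γ u ∧ γ u < χ u) ∧ ∀ t : ℝ, 0 < t → (f t u = 0 ↔ t = F u)) ∧
      Tendsto F (𝓝[>] (1 : ℝ)) atTop := by
  have hs : 0 < Real.sqrt α := Real.sqrt_pos.2 hα
  have hs2 : Real.sqrt α ^ 2 = α := Real.sq_sqrt hα.le
  have hc : 0 < 1 - ρ ^ 2 := by
    rw [sub_pos, sq_lt_one_iff_abs_lt_one]
    exact hρ
  have hQ (u : ℝ) : χ u ^ 2 + α * u * (1 - u) =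
      β ^ 2 + Real.sqrt α * (2 * β * ρ + Real.sqrt α) * u
        - (1 - ρ ^ 2) * Real.sqrt α ^ 2 * u ^ 2 := by
    rw [hχ]
    linear_combination (u ^ 2 - u) * hs2
  have hQ1 := hQ 1
  obtain ⟨hup1, hpos⟩ := one_lt_root_and_quadratic_pos (β := β) (B := 2 * β * ρ + Real.sqrt α)
    hs hc (by nlinarith [pow_pos hχ1 2])
  rw [← hup] at hup1 hpos
  have hQpos : ∀ u ∈ Set.Ioo 1 up, 0 < χ u ^ 2 + α * u * (1 - u) := fun u hu => by
    rw [hQ]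
    exact hpos u hu
  have hχpos : ∀ u ∈ Set.Ioo 1 up, 0 < χ u := fun u hu => by
    rw [hχ, mul_assoc]
    refine affine_pos_of_quadratic_pos hα (by rw [← mul_assoc, ← hχ]; exact hχ1) (w := up)
      (fun y hy => ?_) hu
    rw [← mul_assoc, ← hχ]
    exact hQpos y hy
  have hγχ : ∀ u ∈ Set.Ioo 1 up, 0 < γ u ∧ γ u < χ u := fun u hu => by
    rw [hγ]
    refine ⟨Real.sqrt_pos.2 (hQpos u hu), (Real.sqrt_lt' (hχpos u hu)).2 ?_⟩
    nlinarith [mul_pos (mul_pos hα (zero_lt_one.trans hu.1)) (sub_pos.2 hu.1)]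
  refine ⟨hup1, fun u hu => ⟨hγχ u hu, fun t _ => ?_⟩, ?_⟩
  · obtain ⟨hg, hgx⟩ := hγχ u hu
    have hr : γ u / χ u ∈ Set.Icc (-1 : ℝ) 1 :=
      ⟨by linarith [div_pos hg (hg.trans hgx)], ((div_lt_one (hg.trans hgx)).2 hgx).le⟩
    rw [hf, cosh_sub_div_mul_sinh_eq_zero_iff hg hgx, hF, ← Real.artanh_eq_half_log hr,
      div_eq_iff two_ne_zero, div_mul_eq_mul_div, eq_div_iff hg.ne']
    constructor <;> intro h <;> linarith
  · have hχ_cont : Continuous χ := by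
      rw [funext hχ]
      fun_prop
    have hγ_cont : Continuous γ := by
      rw [funext hγ]
      fun_prop
    have hγ1 : γ 1 = χ 1 := by
      rw [hγ, sub_self, mul_zero, add_zero, Real.sqrt_sq hχ1.le]
    have hγ1_pos : 0 < γ 1 := hγ1 ▸ hχ1
    have hγ_tendsto : Tendsto γ (𝓝[>] 1) (𝓝 (γ 1)) :=
      hγ_cont.continuousAt.tendsto.mono_left nhdsWithin_le_nhds
    have hχ_tendsto : Tendsto χ (𝓝[>] 1) (𝓝 (χ 1)) :=
      hχ_cont.continuousAt.tendsto.mono_left nhdsWithin_le_nhds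
    have hratio : Tendsto (fun u => γ u / χ u) (𝓝[>] 1) (𝓝[<] 1) := by
      refine tendsto_nhdsWithin_iff.2 ⟨?_, ?_⟩
      · have h := hγ_tendsto.div hχ_tendsto hχ1.ne'
        rwa [hγ1, div_self hχ1.ne'] at h
      · filter_upwards [Ioo_mem_nhdsGT hup1] with u hu
        exact (div_lt_one (hχpos u hu)).2 (hγχ u hu).2
    have h := (hγ_tendsto.inv₀ hγ1_pos.ne').pos_mul_atTop (inv_pos.2 hγ1_pos)
      (tendsto_log_one_add_div_one_sub_atTop.comp hratio)
    refine h.congr fun u => ?_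
    rw [hF, Function.comp_apply]
    ring
end

section
/- Let u ∈ ℝ satisfy χ(u)² + αu(1−u) > 0 and χ(u) < γ(u). Then f_t(u) > 0 for all t ≥ 0, and lim_{t→∞} Λ_t(u)/t = Λ(u), where Λ(u) := −(b/α)·(χ(u) + γ(u)) + (a/2)·u(u−1). -/
open Real Set Filter Topology

/-- For `r < 1`, the combination `cosh s - r * sinh s` is positive on `s ≥ 0`. -/
theorem cosh_sub_mul_sinh_pos {r s : ℝ} (hr : r < 1) (hs : 0 ≤ s) :
    0 < cosh s - r * sinh s := by
  have h : 0 ≤ sinh s := sinh_nonneg_iff.2 hs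
  nlinarith [sinh_lt_cosh s]

theorem cosh_sub_mul_sinh_eq_exp_mul (r s : ℝ) :
    cosh s - r * sinh s = exp s * ((1 - r) / 2 + (1 + r) / 2 * exp (-s) ^ 2) := by
  have h : exp s * exp (-s) = 1 := by rw [← exp_add]; simp
  rw [cosh_eq, sinh_eq]
  linear_combination (-(1 + r) / 2 * exp (-s)) * h

theorem sinh_eq_exp_mul (s : ℝ) : sinh s = exp s * ((1 - exp (-s) ^ 2) / 2) := by
  have h : exp s * exp (-s) = 1 := by rw [← exp_add]; simp
  rw [sinh_eq]
  linear_combination (1 / 2 * exp (-s)) * h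

theorem tendsto_exp_mul_sub_factor (r : ℝ) :
    Tendsto (fun s : ℝ => (1 - r) / 2 + (1 + r) / 2 * exp (-s) ^ 2) atTop (𝓝 ((1 - r) / 2)) := by
  simpa using ((tendsto_exp_neg_atTop_nhds_zero.pow 2).const_mul ((1 + r) / 2)).const_add
    ((1 - r) / 2)

/-- For `r < 1`, `log (cosh s - r * sinh s) = s + O(1)` as `s → ∞`, with explicit constant. -/
theorem tendsto_log_cosh_sub_mul_sinh_sub_self {r : ℝ} (hr : r < 1) :
    Tendsto (fun s : ℝ => log (cosh s - r * sinh s) - s) atTop (𝓝 (log ((1 - r) / 2))) := by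
  have hpos : 0 < (1 - r) / 2 := by linarith
  have hlim := tendsto_exp_mul_sub_factor r
  refine (hlim.log hpos.ne').congr' ?_
  filter_upwards [hlim.eventually_ne hpos.ne'] with s hs
  rw [cosh_sub_mul_sinh_eq_exp_mul, log_mul (exp_pos s).ne' hs, log_exp]
  ring

theorem tendsto_sinh_div_cosh_sub_mul_sinh {r : ℝ} (hr : r < 1) :
    Tendsto (fun s : ℝ => sinh s / (cosh s - r * sinh s)) atTop (𝓝 (1 / (1 - r))) := by
  have hpos : 0 < (1 - r) / 2 := by linarith
  have hnum : Tendsto (fun s : ℝ => (1 - exp (-s) ^ 2) / 2) atTop (𝓝 (1 / 2)) := by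
    simpa using ((tendsto_exp_neg_atTop_nhds_zero.pow 2).const_sub 1).div_const 2
  have hlim := hnum.div (tendsto_exp_mul_sub_factor r) hpos.ne'
  rw [div_div_div_cancel_right₀ two_ne_zero] at hlim
  refine hlim.congr fun s => ?_
  rw [cosh_sub_mul_sinh_eq_exp_mul, sinh_eq_exp_mul, mul_div_mul_left _ _ (exp_pos s).ne']
  rfl

/-- if χ(u)² + αu(1−u) > 0 and χ(u) < γ(u), then f_t(u) > 0 for all
t ≥ 0 and Λ_t(u)/t converges to Λ(u) = −(b/α)(χ(u)+γ(u)) + (a/2)u(u−1). -/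
theorem limiting_cgf
    (a b α β ρ v : ℝ) (ha : 0 ≤ a) (hb : 0 ≤ b) (hα : 0 < α) (hρ : |ρ| ≤ 1) (hv : 0 < v)
    (χ γ : ℝ → ℝ) (f : ℝ → ℝ → ℝ) (Λt : ℝ → ℝ → ℝ)
    (hχ : ∀ u, χ u = β + u * ρ * Real.sqrt α)
    (hγ : ∀ u, γ u = Real.sqrt (χ u ^ 2 + α * u * (1 - u)))
    (hf : ∀ t u, f t u = Real.cosh (γ u * t / 2) - (χ u / γ u) * Real.sinh (γ u * t / 2))
    (hΛt : ∀ t u, Λt t u = -(2 * b / α) * (χ u * t / 2 + Real.log (f t u))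
        + u * (u - 1) * v * Real.sinh (γ u * t / 2) / (f t u * γ u)
        + (a / 2) * u * (u - 1) * t)
    (u : ℝ) (hu : 0 < χ u ^ 2 + α * u * (1 - u)) (hχγ : χ u < γ u) :
    (∀ t : ℝ, 0 ≤ t → 0 < f t u) ∧
      Tendsto (fun t : ℝ => Λt t u / t) atTop
        (𝓝 (-(b / α) * (χ u + γ u) + (a / 2) * u * (u - 1))) := by
  have hγpos : 0 < γ u := by rw [hγ]; exact Real.sqrt_pos.2 hu
  have hr : χ u / γ u < 1 := (div_lt_one hγpos).2 hχγ
  refine ⟨fun t ht => ?_, ?_⟩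
  · rw [hf]
    exact cosh_sub_mul_sinh_pos hr (by positivity)
  have harg : Tendsto (fun t : ℝ => γ u * t / 2) atTop atTop :=
    (tendsto_id.const_mul_atTop hγpos).atTop_div_const two_pos
  have hlog := ((tendsto_log_cosh_sub_mul_sinh_sub_self hr).comp harg).div_atTop tendsto_id
  have hsinh := ((tendsto_sinh_div_cosh_sub_mul_sinh hr).comp harg).div_atTop tendsto_id
  have hlim := (((hlog.const_add ((χ u + γ u) / 2)).const_mul (-(2 * b / α))).add
    (hsinh.const_mul (u * (u - 1) * v / γ u))).add_const (a / 2 * u * (u - 1))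
  have hval : -(2 * b / α) * ((χ u + γ u) / 2 + 0) + u * (u - 1) * v / γ u * 0
      + a / 2 * u * (u - 1) = -(b / α) * (χ u + γ u) + a / 2 * u * (u - 1) := by ring
  rw [hval] at hlim
  refine hlim.congr' ?_
  filter_upwards [eventually_gt_atTop 0] with t ht
  simp only [Function.comp_apply, id, hΛt, ← hf]
  have hfne : f t u ≠ 0 := by
    rw [hf]
    exact (cosh_sub_mul_sinh_pos hr (by positivity)).ne'
  field_simp
  ring
end

section
/- Let u ∈ ℝ satisfy χ(u)² + αu(1−u) > 0 and χ(u) < γ(u), and set Λ(u) := −(b/α)·(χ(u) + γ(u)) + (a/2)·u(u−1). Then lim_{t→∞} ( Λ_t(u) − t·Λ(u) ) = −(2b/α)·log( (γ(u) − χ(u))/(2γ(u)) ) + u(u−1)·v/(γ(u) − χ(u)). -/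
open Real Set Filter Topology

/-- Factoring the exponential growth out of the hyperbolic sine. -/
lemma sinh_eq_exp_mul_one_sub_exp (y : ℝ) :
    Real.sinh y = Real.exp y * ((1 - Real.exp (-(2 * y))) / 2) := by
  have h : Real.exp (-y) = Real.exp y * Real.exp (-(2 * y)) := by
    rw [← Real.exp_add]; ring_nf
  rw [Real.sinh_eq, h]
  ring

/-- Factoring the exponential growth out of `cosh y - r * sinh y`. -/
lemma cosh_sub_mul_sinh_eq_exp_mul_s7 (r y : ℝ) :
    Real.cosh y - r * Real.sinh y =
      Real.exp y * (((1 - r) + (1 + r) * Real.exp (-(2 * y))) / 2) := by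
  have h : Real.exp (-y) = Real.exp y * Real.exp (-(2 * y)) := by
    rw [← Real.exp_add]; ring_nf
  rw [Real.cosh_eq, Real.sinh_eq, h]
  ring

/-- second-order expansion of the cumulant generating function:
Λ_t(u) − tΛ(u) → −(2b/α)·log((γ(u)−χ(u))/(2γ(u))) + u(u−1)v/(γ(u)−χ(u)). -/
theorem cgf_second_order_limit
    (a b α β ρ v : ℝ) (ha : 0 ≤ a) (hb : 0 ≤ b) (hα : 0 < α) (hρ : |ρ| ≤ 1) (hv : 0 < v)
    (χ γ : ℝ → ℝ) (f : ℝ → ℝ → ℝ) (Λt : ℝ → ℝ → ℝ) (Λ : ℝ → ℝ)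
    (hχ : ∀ u, χ u = β + u * ρ * Real.sqrt α)
    (hγ : ∀ u, γ u = Real.sqrt (χ u ^ 2 + α * u * (1 - u)))
    (hf : ∀ t u, f t u = Real.cosh (γ u * t / 2) - (χ u / γ u) * Real.sinh (γ u * t / 2))
    (hΛt : ∀ t u, Λt t u = -(2 * b / α) * (χ u * t / 2 + Real.log (f t u))
        + u * (u - 1) * v * Real.sinh (γ u * t / 2) / (f t u * γ u)
        + (a / 2) * u * (u - 1) * t)
    (hΛ : ∀ u, Λ u = -(b / α) * (χ u + γ u) + (a / 2) * u * (u - 1))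
    (u : ℝ) (hu : 0 < χ u ^ 2 + α * u * (1 - u)) (hχγ : χ u < γ u) :
    Tendsto (fun t : ℝ => Λt t u - t * Λ u) atTop
      (𝓝 (-(2 * b / α) * Real.log ((γ u - χ u) / (2 * γ u))
        + u * (u - 1) * v / (γ u - χ u))) := by
  have hc : 0 < γ u := by
    rw [hγ]
    exact Real.sqrt_pos.mpr hu
  have hlim : (0 : ℝ) < (γ u - χ u) / (2 * γ u) :=
    div_pos (sub_pos.mpr hχγ) (by positivity)
  have hE : Tendsto (fun t : ℝ => Real.exp (-(γ u * t))) atTop (𝓝 0) :=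
    Real.tendsto_exp_neg_atTop_nhds_zero.comp (tendsto_id.const_mul_atTop hc)
  set g : ℝ → ℝ := fun t =>
    ((1 - χ u / γ u) + (1 + χ u / γ u) * Real.exp (-(γ u * t))) / 2
  have hgt : Tendsto g atTop (𝓝 ((γ u - χ u) / (2 * γ u))) := by
    have h := ((hE.const_mul (1 + χ u / γ u)).const_add (1 - χ u / γ u)).div_const 2
    convert h using 2
    field_simp
    ring
  have hmain : Tendsto (fun t => -(2 * b / α) * Real.log (g t)
      + u * (u - 1) * v * ((1 - Real.exp (-(γ u * t))) / 2) / (g t * γ u)) atTop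
      (𝓝 (-(2 * b / α) * Real.log ((γ u - χ u) / (2 * γ u))
        + u * (u - 1) * v / (γ u - χ u))) := by
    have h := ((hgt.log hlim.ne').const_mul (-(2 * b / α))).add
      ((((hE.const_sub 1).div_const 2).const_mul (u * (u - 1) * v)).div
        (hgt.mul_const (γ u)) (mul_pos hlim hc).ne')
    have hval : u * (u - 1) * v * ((1 - 0) / 2) / ((γ u - χ u) / (2 * γ u) * γ u) =
        u * (u - 1) * v / (γ u - χ u) := by
      have : γ u - χ u ≠ 0 := (sub_pos.mpr hχγ).ne'
      field_simp
      ring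
    rw [hval] at h
    exact h
  refine hmain.congr' ?_
  filter_upwards [hgt.eventually_const_lt hlim] with t ht
  have htwo : 2 * (γ u * t / 2) = γ u * t := by ring
  have hft : f t u = Real.exp (γ u * t / 2) * g t := by
    rw [hf, cosh_sub_mul_sinh_eq_exp_mul_s7, htwo]
  have hexp : Real.exp (γ u * t / 2) ≠ 0 := Real.exp_ne_zero _
  have hfrac : u * (u - 1) * v * Real.sinh (γ u * t / 2) / (f t u * γ u) =
      u * (u - 1) * v * ((1 - Real.exp (-(γ u * t))) / 2) / (g t * γ u) := by
    rw [hft, sinh_eq_exp_mul_one_sub_exp, htwo, mul_left_comm, mul_assoc (Real.exp _),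
      mul_div_mul_left _ _ hexp]
  rw [hΛt, hΛ, hfrac, hft, Real.log_mul hexp ht.ne', Real.log_exp]
  ring
end

section
/- Assume |ρ| < 1 and that a > 0 or b > 0. Then the function Λ(u) := −(b/α)·(χ(u) + γ(u)) + (a/2)·u(u−1) is infinitely differentiable on the open interval (u_−, u_+), and its second derivative satisfies Λ''(u) > 0 for every u ∈ (u_−, u_+); in particular Λ is strictly convex on (u_−, u_+). -/
open Real Set

/-- A concave quadratic is positive strictly between the two numbers given by the root formula. -/
lemma quadratic_pos_of_mem_Ioo {s k m β u : ℝ} (hs : 0 < s) (hk : 0 < k)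
    (hu : u ∈ Ioo ((m - √(m ^ 2 + 4 * β ^ 2 * k)) / (2 * s * k))
      ((m + √(m ^ 2 + 4 * β ^ 2 * k)) / (2 * s * k))) :
    0 < -(s ^ 2 * k) * u ^ 2 + s * m * u + β ^ 2 := by
  obtain ⟨h1, h2⟩ := hu
  rw [div_lt_iff₀ (by positivity)] at h1
  rw [lt_div_iff₀ (by positivity)] at h2
  have hr : √(m ^ 2 + 4 * β ^ 2 * k) ^ 2 = m ^ 2 + 4 * β ^ 2 * k := Real.sq_sqrt (by positivity)
  have h := mul_pos (sub_pos.2 h1) (sub_pos.2 h2)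
  have h4 : 0 < 4 * k * (-(s ^ 2 * k) * u ^ 2 + s * m * u + β ^ 2) := by
    nlinarith
  exact pos_of_mul_pos_right h4 (by positivity)

lemma hasDerivAt_quadratic (A B C u : ℝ) :
    HasDerivAt (fun x => -A * x ^ 2 + B * x + C) (-(2 * A * u) + B) u := by
  have h := (((hasDerivAt_pow 2 u).const_mul (-A)).add ((hasDerivAt_id u).const_mul B)).add_const C
  refine h.congr_deriv ?_
  norm_num
  ring

lemma hasDerivAt_sqrt_quadratic {A B C u : ℝ} (h : 0 < -A * u ^ 2 + B * u + C) :
    HasDerivAt (fun x => √(-A * x ^ 2 + B * x + C))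
      ((-(2 * A * u) + B) / (2 * √(-A * u ^ 2 + B * u + C))) u :=
  (hasDerivAt_quadratic A B C u).sqrt h.ne'

/-- The derivative of the derivative of the square root of a concave quadratic is negative. -/
lemma exists_neg_hasDerivAt_deriv_sqrt_quadratic {A B C u : ℝ} (hA : 0 < A)
    (h : 0 < -A * u ^ 2 + B * u + C) :
    ∃ d < 0, HasDerivAt (fun x => (-(2 * A * x) + B) / (2 * √(-A * x ^ 2 + B * x + C))) d u := by
  have hr : 0 < √(-A * u ^ 2 + B * u + C) := Real.sqrt_pos.2 h
  have hnum : HasDerivAt (fun x => -(2 * A * x) + B) (-(2 * A)) u := by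
    simpa using (((hasDerivAt_id u).const_mul (2 * A)).neg.add_const B)
  refine ⟨_, ?_, hnum.div ((hasDerivAt_sqrt_quadratic h).const_mul 2) (by positivity)⟩
  refine div_neg_of_neg_of_pos ?_ (by positivity)
  generalize √(-A * u ^ 2 + B * u + C) = r at hr
  have e : (-(2 * A * u) + B) * (2 * ((-(2 * A * u) + B) / (2 * r)))
      = (-(2 * A * u) + B) ^ 2 / r := by field_simp
  rw [e]
  have : 0 ≤ (-(2 * A * u) + B) ^ 2 / r := by positivity
  nlinarith [mul_pos hA hr]

/-- if |ρ| < 1 and a > 0 or b > 0, then Λ is infinitely differentiable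
on (u₋, u₊) with strictly positive second derivative there; in particular Λ is
strictly convex on (u₋, u₊). -/
theorem lambda_smooth_strictly_convex
    (a b α β ρ v : ℝ) (ha : 0 ≤ a) (hb : 0 ≤ b) (hα : 0 < α) (hρ : |ρ| < 1) (hv : 0 < v)
    (hab : 0 < a ∨ 0 < b)
    (χ γ Λ : ℝ → ℝ) (um up : ℝ)
    (hχ : ∀ u, χ u = β + u * ρ * Real.sqrt α)
    (hγ : ∀ u, γ u = Real.sqrt (χ u ^ 2 + α * u * (1 - u)))
    (hΛ : ∀ u, Λ u = -(b / α) * (χ u + γ u) + (a / 2) * u * (u - 1))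
    (hum : um = (2 * β * ρ + Real.sqrt α
        - Real.sqrt ((2 * β * ρ + Real.sqrt α) ^ 2 + 4 * β ^ 2 * (1 - ρ ^ 2)))
        / (2 * Real.sqrt α * (1 - ρ ^ 2)))
    (hup : up = (2 * β * ρ + Real.sqrt α
        + Real.sqrt ((2 * β * ρ + Real.sqrt α) ^ 2 + 4 * β ^ 2 * (1 - ρ ^ 2)))
        / (2 * Real.sqrt α * (1 - ρ ^ 2))) :
    ContDiffOn ℝ (⊤ : ℕ∞) Λ (Set.Ioo um up) ∧
      (∀ u ∈ Set.Ioo um up, 0 < deriv (deriv Λ) u) ∧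
      StrictConvexOn ℝ (Set.Ioo um up) Λ := by
  have hs : 0 < √α := Real.sqrt_pos.2 hα
  have hsq : √α ^ 2 = α := Real.sq_sqrt hα.le
  have hk : 0 < 1 - ρ ^ 2 := by
    have := (sq_lt_one_iff_abs_lt_one ρ).2 hρ
    linarith
  set A : ℝ := √α ^ 2 * (1 - ρ ^ 2) with hA
  set B : ℝ := √α * (2 * β * ρ + √α) with hB
  have hApos : 0 < A := by positivity
  have hQ : ∀ u ∈ Ioo um up, 0 < -A * u ^ 2 + B * u + β ^ 2 := by
    intro u hu
    rw [hum, hup] at hu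
    exact quadratic_pos_of_mem_Ioo hs hk hu
  have hΛ' : Λ = fun u => -(b / α) * (β + u * ρ * √α + √(-A * u ^ 2 + B * u + β ^ 2))
      + (a / 2) * u * (u - 1) := by
    funext u
    rw [hΛ, hγ, hχ]
    congr 4
    rw [hA, hB]
    linear_combination (-u + u ^ 2) * hsq
  have hsmooth : ContDiffOn ℝ (⊤ : ℕ∞) Λ (Ioo um up) := by
    rw [hΛ']
    have h : ContDiffOn ℝ (⊤ : ℕ∞) (fun u => √(-A * u ^ 2 + B * u + β ^ 2)) (Ioo um up) :=
      ContDiffOn.sqrt (by fun_prop) fun u hu => (hQ u hu).ne'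
    fun_prop
  have hd : ∀ u ∈ Ioo um up, deriv Λ u = -(b / α) * (ρ * √α +
      (-(2 * A * u) + B) / (2 * √(-A * u ^ 2 + B * u + β ^ 2))) + a / 2 * (2 * u - 1) := by
    intro u hu
    have h1 : HasDerivAt (fun u : ℝ => β + u * ρ * √α) (ρ * √α) u := by
      simpa using (((hasDerivAt_id u).mul_const ρ).mul_const √α).const_add β
    have h2 : HasDerivAt (fun u : ℝ => a / 2 * u * (u - 1)) (a / 2 * (2 * u - 1)) u := by
      refine (((hasDerivAt_id u).const_mul (a / 2)).mul
        ((hasDerivAt_id u).sub_const 1)).congr_deriv ?_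
      simp only [id]
      ring
    rw [hΛ']
    exact (((h1.add (hasDerivAt_sqrt_quadratic (hQ u hu))).const_mul (-(b / α))).add h2).deriv
  have hdd : ∀ u ∈ Ioo um up, 0 < deriv (deriv Λ) u := by
    intro u hu
    obtain ⟨d, hd0, hder⟩ := exists_neg_hasDerivAt_deriv_sqrt_quadratic hApos (hQ u hu)
    have h2 : HasDerivAt (fun u : ℝ => a / 2 * (2 * u - 1)) a u := by
      refine ((((hasDerivAt_id u).const_mul 2).sub_const 1).const_mul (a / 2)).congr_deriv ?_
      ring
    have heq : deriv Λ =ᶠ[nhds u] _ :=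
      Filter.eventually_of_mem (isOpen_Ioo.mem_nhds hu) hd
    refine lt_of_lt_of_eq ?_ (heq.deriv_eq.trans
      (((hder.const_add (ρ * √α)).const_mul (-(b / α))).add h2).deriv).symm
    have hnd : 0 < -d := neg_pos.2 hd0
    rw [show -(b / α) * d + a = b / α * -d + a by ring]
    rcases hab with h | h <;> positivity
  exact ⟨hsmooth, hdd,
    strictConvexOn_of_deriv2_pos' (convex_Ioo um up) hsmooth.continuousOn hdd⟩
end

section
/- Assume |ρ| < 1, b > 0, χ(0) < 0 and χ(1) < 0, and define the Fenchel–Legendre transform Λ*(x) := sup_{u ∈ [u_−, u_+]} ( u·x − Λ(u) ). Then for every x ∈ ℝ the supremum Λ*(x) is finite and satisfies Λ*(x) ≥ 0, with equality Λ*(x) = 0 if and only if x = Λ'(0), the derivative of Λ at u = 0. -/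
open Real Set

/-- The upper root and lower root of `β² + s(2βρ + s)u - s²(1 - ρ²)u²` factor this quadratic. -/
lemma heston_quadratic_factor {β ρ s um up : ℝ} (hs : 0 < s) (hρ : 0 < 1 - ρ ^ 2)
    (hum : um = (2 * β * ρ + s
        - Real.sqrt ((2 * β * ρ + s) ^ 2 + 4 * β ^ 2 * (1 - ρ ^ 2))) / (2 * s * (1 - ρ ^ 2)))
    (hup : up = (2 * β * ρ + s
        + Real.sqrt ((2 * β * ρ + s) ^ 2 + 4 * β ^ 2 * (1 - ρ ^ 2))) / (2 * s * (1 - ρ ^ 2)))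
    (u : ℝ) :
    (β + u * ρ * s) ^ 2 + s ^ 2 * u * (1 - u) = s ^ 2 * (1 - ρ ^ 2) * ((u - um) * (up - u)) := by
  have hD := Real.sq_sqrt (show 0 ≤ (2 * β * ρ + s) ^ 2 + 4 * β ^ 2 * (1 - ρ ^ 2) by positivity)
  set d := Real.sqrt ((2 * β * ρ + s) ^ 2 + 4 * β ^ 2 * (1 - ρ ^ 2))
  have hk : 2 * s * (1 - ρ ^ 2) ≠ 0 := by positivity
  have h1 : um * (2 * s * (1 - ρ ^ 2)) = 2 * β * ρ + s - d := by rw [hum]; field_simp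
  have h2 : up * (2 * s * (1 - ρ ^ 2)) = 2 * β * ρ + s + d := by rw [hup]; field_simp
  have h3 : 4 * (1 - ρ ^ 2) * (s ^ 2 * (1 - ρ ^ 2) * ((u - um) * (up - u)))
      = (u * (2 * s * (1 - ρ ^ 2)) - um * (2 * s * (1 - ρ ^ 2)))
        * (up * (2 * s * (1 - ρ ^ 2)) - u * (2 * s * (1 - ρ ^ 2))) := by ring
  refine mul_left_cancel₀ (show 4 * (1 - ρ ^ 2) ≠ 0 by positivity) ?_
  rw [h3, h1, h2]
  linear_combination -hD

/-- The roots of `β² + s(2βρ + s)u - s²(1 - ρ²)u²` have opposite signs when `β ≠ 0`. -/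
lemma heston_roots_sign {β ρ s um up : ℝ} (hβ : β ≠ 0) (hs : 0 < s) (hρ : 0 < 1 - ρ ^ 2)
    (hum : um = (2 * β * ρ + s
        - Real.sqrt ((2 * β * ρ + s) ^ 2 + 4 * β ^ 2 * (1 - ρ ^ 2))) / (2 * s * (1 - ρ ^ 2)))
    (hup : up = (2 * β * ρ + s
        + Real.sqrt ((2 * β * ρ + s) ^ 2 + 4 * β ^ 2 * (1 - ρ ^ 2))) / (2 * s * (1 - ρ ^ 2))) :
    um < 0 ∧ 0 < up := by
  have hlt : |2 * β * ρ + s| <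
      Real.sqrt ((2 * β * ρ + s) ^ 2 + 4 * β ^ 2 * (1 - ρ ^ 2)) := by
    refine Real.lt_sqrt_of_sq_lt ?_
    rw [sq_abs]
    have : 0 < 4 * β ^ 2 * (1 - ρ ^ 2) := by positivity
    linarith
  obtain ⟨h1, h2⟩ := abs_lt.mp hlt
  rw [hum, hup]
  exact ⟨div_neg_of_neg_of_pos (by linarith) (by positivity), div_pos (by linarith) (by positivity)⟩

/-- A square root lies below its tangent at a point where the radicand equals `g² > 0`. -/
lemma sqrt_le_add_div_of_pos {q g : ℝ} (hq : 0 ≤ q) (hg : 0 < g) :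
    Real.sqrt q ≤ g + (q - g ^ 2) / (2 * g) := by
  have h : g + (q - g ^ 2) / (2 * g) = (q + g ^ 2) / (2 * g) := by field_simp; ring
  rw [h, le_div_iff₀ (by positivity)]
  nlinarith [sq_nonneg (Real.sqrt q - g), Real.sq_sqrt hq]

/-- with |ρ| < 1, b > 0, χ(0) < 0 and χ(1) < 0, the Fenchel–Legendre
transform Λ*(x) = sup_{u ∈ [u₋,u₊]} (ux − Λ(u)) is finite, nonnegative, and vanishes
exactly at x = Λ'(0). -/
theorem rate_function_nonneg
    (a b α β ρ v : ℝ) (ha : 0 ≤ a) (hb : 0 < b) (hα : 0 < α) (hρ : |ρ| < 1) (hv : 0 < v)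
    (χ γ Λ : ℝ → ℝ) (um up : ℝ) (Λstar : ℝ → ℝ)
    (hχ : ∀ u, χ u = β + u * ρ * Real.sqrt α)
    (hγ : ∀ u, γ u = Real.sqrt (χ u ^ 2 + α * u * (1 - u)))
    (hΛ : ∀ u, Λ u = -(b / α) * (χ u + γ u) + (a / 2) * u * (u - 1))
    (hum : um = (2 * β * ρ + Real.sqrt α
        - Real.sqrt ((2 * β * ρ + Real.sqrt α) ^ 2 + 4 * β ^ 2 * (1 - ρ ^ 2)))
        / (2 * Real.sqrt α * (1 - ρ ^ 2)))
    (hup : up = (2 * β * ρ + Real.sqrt α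
        + Real.sqrt ((2 * β * ρ + Real.sqrt α) ^ 2 + 4 * β ^ 2 * (1 - ρ ^ 2)))
        / (2 * Real.sqrt α * (1 - ρ ^ 2)))
    (hχ0 : χ 0 < 0) (hχ1 : χ 1 < 0)
    (hΛstar : ∀ x, Λstar x = sSup ((fun u => u * x - Λ u) '' Set.Icc um up)) :
    ∀ x : ℝ,
      BddAbove ((fun u => u * x - Λ u) '' Set.Icc um up) ∧
      0 ≤ Λstar x ∧ (Λstar x = 0 ↔ x = deriv Λ 0) := by
  have hβ : β < 0 := by simpa [hχ] using hχ0
  have hs : 0 < Real.sqrt α := Real.sqrt_pos.mpr hα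
  have hss : Real.sqrt α ^ 2 = α := Real.sq_sqrt hα.le
  have hρ' : 0 < 1 - ρ ^ 2 := by linarith [(sq_lt_one_iff_abs_lt_one ρ).mpr hρ]
  obtain ⟨hum0, hup0⟩ := heston_roots_sign hβ.ne hs hρ' hum hup
  have hΛ' : Λ = fun u => -(b / α) * ((β + u * ρ * Real.sqrt α)
      + Real.sqrt ((β + u * ρ * Real.sqrt α) ^ 2 + α * u * (1 - u)))
      + (a / 2) * u * (u - 1) := by
    funext u
    rw [hΛ, hγ, hχ]
  have hΛ0 : Λ 0 = 0 := by
    rw [hΛ']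
    simp [Real.sqrt_sq_eq_abs, abs_of_neg hβ]
  have hderiv : HasDerivAt Λ (-(b / α) * (ρ * Real.sqrt α
      + (2 * β * ρ * Real.sqrt α + α) / (2 * -β)) - a / 2) 0 := by
    have hχd : HasDerivAt (fun u : ℝ => β + u * ρ * Real.sqrt α) (ρ * Real.sqrt α) 0 := by
      simpa using (((hasDerivAt_id (0 : ℝ)).mul_const ρ).mul_const (Real.sqrt α)).const_add β
    have hQd : HasDerivAt (fun u : ℝ => (β + u * ρ * Real.sqrt α) ^ 2 + α * u * (1 - u))
        (2 * β * ρ * Real.sqrt α + α) 0 := by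
      refine ((hχd.fun_pow 2).fun_add (((hasDerivAt_id' (0 : ℝ)).const_mul α).fun_mul
        ((hasDerivAt_id' (0 : ℝ)).const_sub 1))).congr_deriv ?_
      norm_num
      ring
    have hpos : (β + 0 * ρ * Real.sqrt α) ^ 2 + α * 0 * (1 - 0) ≠ 0 := by simpa using hβ.ne
    have hroot : Real.sqrt ((β + 0 * ρ * Real.sqrt α) ^ 2 + α * 0 * (1 - 0)) = -β := by
      simp [Real.sqrt_sq_eq_abs, abs_of_neg hβ]
    have hquad : HasDerivAt (fun u : ℝ => (a / 2) * u * (u - 1)) (-(a / 2)) 0 := by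
      refine (((hasDerivAt_id' (0 : ℝ)).const_mul (a / 2)).fun_mul
        ((hasDerivAt_id' (0 : ℝ)).sub_const 1)).congr_deriv ?_
      ring
    have hγd := hQd.sqrt hpos
    rw [hroot] at hγd
    rw [hΛ', sub_eq_add_neg]
    exact ((hχd.fun_add hγd).const_mul (-(b / α))).fun_add hquad
  have htangent : ∀ u ∈ Set.Icc um up, u * deriv Λ 0 ≤ Λ u := by
    intro u hu
    have hQ : 0 ≤ (β + u * ρ * Real.sqrt α) ^ 2 + α * u * (1 - u) := by
      have h := heston_quadratic_factor hs hρ' hum hup u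
      rw [hss] at h
      rw [h]
      exact mul_nonneg (by positivity)
        (mul_nonneg (sub_nonneg.mpr hu.1) (sub_nonneg.mpr hu.2))
    have hquad : (β + u * ρ * Real.sqrt α) ^ 2 + α * u * (1 - u) - (-β) ^ 2
        ≤ (2 * β * ρ * Real.sqrt α + α) * u := by
      have h : 0 ≤ α * (1 - ρ ^ 2) * u ^ 2 := by positivity
      linear_combination h + u ^ 2 * ρ ^ 2 * hss
    have hsqrt := (sqrt_le_add_div_of_pos hQ (neg_pos.mpr hβ)).trans
      (add_le_add_right (div_le_div_of_nonneg_right hquad (by linarith)) (-β))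
    have hmul := mul_le_mul_of_nonneg_left hsqrt (div_pos hb hα).le
    rw [hderiv.deriv, hΛ']
    have ha' : 0 ≤ a / 2 * u ^ 2 := by positivity
    linear_combination hmul + ha'
  intro x
  have hbdd : BddAbove ((fun u => u * x - Λ u) '' Set.Icc um up) := by
    refine isCompact_Icc.bddAbove_image (Continuous.continuousOn ?_)
    rw [hΛ']
    fun_prop
  have hle : ∀ u ∈ Set.Icc um up, u * x - Λ u ≤ Λstar x := fun u hu => by
    rw [hΛstar]
    exact le_csSup hbdd ⟨u, hu, rfl⟩
  have h0 : 0 ≤ Λstar x := by simpa [hΛ0] using hle 0 ⟨hum0.le, hup0.le⟩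
  refine ⟨hbdd, h0, fun hx => ?_, fun hx => le_antisymm ?_ h0⟩
  · have hmin : IsLocalMin (fun u => Λ u - u * x) 0 := by
      filter_upwards [Icc_mem_nhds hum0 hup0] with u hu
      have h := hle u hu
      simp only [hΛ0]
      linarith
    have h := hmin.hasDerivAt_eq_zero
      (hderiv.differentiableAt.hasDerivAt.fun_sub ((hasDerivAt_id' (0 : ℝ)).mul_const x))
    linarith
  · rw [hΛstar]
    refine csSup_le (Set.Nonempty.image _ ⟨0, hum0.le, hup0.le⟩) ?_
    rintro _ ⟨u, hu, rfl⟩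
    have h := htangent u hu
    rw [← hx] at h
    simpa using h
end

section
/- Assume |ρ| < 1, b > 0, χ(0) < 0 and χ(1) < 0, and define the Fenchel–Legendre transform Λ*(x) := sup_{u ∈ [u_−, u_+]} ( u·x − Λ(u) ). Then for every x ∈ ℝ one has Λ*(x) ≥ x, with equality Λ*(x) = x if and only if x = Λ'(1), the derivative of Λ at u = 1; i.e. x = Λ'(1) is the unique real solution of the equation Λ*(x) = x. -/
open Real Set

/-- A quadratic with negative leading coefficient `-s ^ 2 * (1 - ρ ^ 2)` factors over its two
roots, as given by the quadratic formula. -/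
theorem quadratic_eq_mul_sub_roots {β ρ s um up : ℝ} (hs : 0 < s) (hρ : 0 < 1 - ρ ^ 2)
    (hum : um = (2 * β * ρ + s - √((2 * β * ρ + s) ^ 2 + 4 * β ^ 2 * (1 - ρ ^ 2)))
        / (2 * s * (1 - ρ ^ 2)))
    (hup : up = (2 * β * ρ + s + √((2 * β * ρ + s) ^ 2 + 4 * β ^ 2 * (1 - ρ ^ 2)))
        / (2 * s * (1 - ρ ^ 2))) (u : ℝ) :
    (β + u * ρ * s) ^ 2 + s ^ 2 * u * (1 - u) = s ^ 2 * (1 - ρ ^ 2) * ((u - um) * (up - u)) := by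
  have hD := Real.sq_sqrt (show 0 ≤ (2 * β * ρ + s) ^ 2 + 4 * β ^ 2 * (1 - ρ ^ 2) by positivity)
  set D := √((2 * β * ρ + s) ^ 2 + 4 * β ^ 2 * (1 - ρ ^ 2))
  have h1 : 2 * s * (1 - ρ ^ 2) * um = 2 * β * ρ + s - D := by
    rw [hum]; field_simp
  have h2 : 2 * s * (1 - ρ ^ 2) * up = 2 * β * ρ + s + D := by
    rw [hup]; field_simp
  have h3 : 4 * (1 - ρ ^ 2) * (s ^ 2 * (1 - ρ ^ 2) * ((u - um) * (up - u)))
      = (1 - ρ ^ 2) * (4 * ((β + u * ρ * s) ^ 2 + s ^ 2 * u * (1 - u))) := by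
    calc _ = (2 * s * (1 - ρ ^ 2) * u - 2 * s * (1 - ρ ^ 2) * um)
          * (2 * s * (1 - ρ ^ 2) * up - 2 * s * (1 - ρ ^ 2) * u) := by ring
      _ = _ := by rw [h1, h2]; linear_combination hD
  have h4 : 4 * (1 - ρ ^ 2) ≠ 0 := by positivity
  exact mul_left_cancel₀ h4 (by linear_combination -h3)

/-- The square root of a concave quadratic lies below its tangent line. -/
theorem sqrt_le_tangent_of_quadratic {g q c t y : ℝ} (hg : 0 < g) (hc : 0 ≤ c)
    (hy : y = g ^ 2 + q * t - c * t ^ 2) (hy0 : 0 ≤ y) :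
    √y ≤ g + q / (2 * g) * t := by
  have h1 := Real.sq_sqrt hy0
  have h2 : g + q / (2 * g) * t = (2 * g ^ 2 + q * t) / (2 * g) := by field_simp
  rw [h2, le_div_iff₀ (by positivity)]
  nlinarith [sq_nonneg (√y - g), mul_nonneg hc (sq_nonneg t)]

/-- with |ρ| < 1, b > 0, χ(0) < 0 and χ(1) < 0, the Fenchel–Legendre
transform satisfies Λ*(x) ≥ x with equality exactly at x = Λ'(1). -/
theorem rate_function_ge_id
    (a b α β ρ v : ℝ) (ha : 0 ≤ a) (hb : 0 < b) (hα : 0 < α) (hρ : |ρ| < 1) (hv : 0 < v)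
    (χ γ Λ : ℝ → ℝ) (um up : ℝ) (Λstar : ℝ → ℝ)
    (hχ : ∀ u, χ u = β + u * ρ * Real.sqrt α)
    (hγ : ∀ u, γ u = Real.sqrt (χ u ^ 2 + α * u * (1 - u)))
    (hΛ : ∀ u, Λ u = -(b / α) * (χ u + γ u) + (a / 2) * u * (u - 1))
    (hum : um = (2 * β * ρ + Real.sqrt α
        - Real.sqrt ((2 * β * ρ + Real.sqrt α) ^ 2 + 4 * β ^ 2 * (1 - ρ ^ 2)))
        / (2 * Real.sqrt α * (1 - ρ ^ 2)))
    (hup : up = (2 * β * ρ + Real.sqrt α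
        + Real.sqrt ((2 * β * ρ + Real.sqrt α) ^ 2 + 4 * β ^ 2 * (1 - ρ ^ 2)))
        / (2 * Real.sqrt α * (1 - ρ ^ 2)))
    (hχ0 : χ 0 < 0) (hχ1 : χ 1 < 0)
    (hΛstar : ∀ x, Λstar x = sSup ((fun u => u * x - Λ u) '' Set.Icc um up)) :
    ∀ x : ℝ,
      BddAbove ((fun u => u * x - Λ u) '' Set.Icc um up) ∧
      x ≤ Λstar x ∧ (Λstar x = x ↔ x = deriv Λ 1) := by
  have hs : 0 < √α := Real.sqrt_pos.2 hα
  have hsα : √α ^ 2 = α := Real.sq_sqrt hα.le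
  have hr : 0 < 1 - ρ ^ 2 := by
    have := (sq_lt_one_iff_abs_lt_one ρ).2 hρ
    linarith
  have hfac := quadratic_eq_mul_sub_roots hs hr hum hup
  have hle : um ≤ up := by
    rw [hum, hup]
    gcongr
    linarith [Real.sqrt_nonneg ((2 * β * ρ + √α) ^ 2 + 4 * β ^ 2 * (1 - ρ ^ 2))]
  rw [hχ] at hχ1
  clear hum hup hχ0
  obtain rfl : χ = fun u => β + u * ρ * √α := funext hχ
  obtain rfl : γ = fun u => √((β + u * ρ * √α) ^ 2 + α * u * (1 - u)) := funext hγ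
  obtain rfl := funext hΛ
  rw [hsα] at hfac
  set g := -(β + ρ * √α) with hg_def
  have hg : 0 < g := by linarith
  have hprod : 0 < (1 - um) * (up - 1) := by
    have h := hfac 1
    have h' : 0 < α * (1 - ρ ^ 2) * ((1 - um) * (up - 1)) := by
      rw [← h]; nlinarith
    exact pos_of_mul_pos_right h' (by positivity)
  have h1 : 1 ∈ Ioo um up := by
    constructor <;> by_contra! h <;> nlinarith
  set Λ : ℝ → ℝ := fun u => -(b / α) * (β + u * ρ * √α + √((β + u * ρ * √α) ^ 2 + α * u * (1 - u)))
    + (a / 2) * u * (u - 1) with hΛ_def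
  have hg1 : √((β + 1 * ρ * √α) ^ 2 + α * 1 * (1 - 1)) = g := by
    rw [show (β + 1 * ρ * √α) ^ 2 + α * 1 * (1 - 1) = g ^ 2 by rw [hg_def]; ring]
    exact Real.sqrt_sq hg.le
  have hΛ1 : Λ 1 = 0 := by
    simp only [hΛ_def, hg1]
    rw [hg_def]; ring
  set q := 2 * β * ρ * √α + α - 2 * (α * (1 - ρ ^ 2)) with hq
  set d := -(b / α) * (ρ * √α + q / (2 * g)) + a / 2 with hd
  have hderiv : HasDerivAt Λ d 1 := by
    have hlin : HasDerivAt (fun u : ℝ => β + u * ρ * √α) (ρ * √α) 1 := by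
      simpa using (((hasDerivAt_id (1 : ℝ)).mul_const ρ).mul_const √α).const_add β
    have hQ : HasDerivAt (fun u : ℝ => (β + u * ρ * √α) ^ 2 + α * u * (1 - u)) q 1 := by
      refine HasDerivAt.congr_deriv ((hlin.pow 2).add (((hasDerivAt_id (1 : ℝ)).const_mul α).mul
        ((hasDerivAt_id (1 : ℝ)).const_sub 1))) ?_
      simp only [hq, id]
      push_cast
      linear_combination (2 * ρ ^ 2) * hsα
    have hsq := hQ.sqrt (by
      intro h
      rw [h, Real.sqrt_zero] at hg1
      exact hg.ne hg1)
    rw [hg1] at hsq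
    refine HasDerivAt.congr_deriv (((hlin.add hsq).const_mul (-(b / α))).add
      (((hasDerivAt_id (1 : ℝ)).const_mul (a / 2)).mul
        ((hasDerivAt_id (1 : ℝ)).sub_const 1))) ?_
    simp only [hd, id]
    ring
  have htangent : ∀ u ∈ Icc um up, d * (u - 1) ≤ Λ u := by
    intro u hu
    have hy0 : 0 ≤ (β + u * ρ * √α) ^ 2 + α * u * (1 - u) := by
      rw [hfac]
      have := mul_nonneg (sub_nonneg.2 hu.1) (sub_nonneg.2 hu.2)
      positivity
    have h := sqrt_le_tangent_of_quadratic (q := q) (c := α * (1 - ρ ^ 2)) (t := u - 1) hg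
      (by positivity) (by
        simp only [hq, hg_def]
        linear_combination (ρ ^ 2 * u ^ 2 - ρ ^ 2) * hsα) hy0
    have h' := mul_nonneg (div_pos hb hα).le (sub_nonneg.2 h)
    have ha' := mul_nonneg ha (sq_nonneg (u - 1))
    simp only [hΛ_def, hd]
    have hβ : β = -g - ρ * √α := by rw [hg_def]; ring
    have : -(b / α) * (β + u * ρ * √α + √((β + u * ρ * √α) ^ 2 + α * u * (1 - u)))
        = b / α * (g - (u - 1) * (ρ * √α) - √((β + u * ρ * √α) ^ 2 + α * u * (1 - u))) := by
      rw [hg_def]; ring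
    rw [this]
    linarith
  have hcont : Continuous Λ := by fun_prop
  intro x
  have hbdd : BddAbove ((fun u => u * x - Λ u) '' Icc um up) :=
    isCompact_Icc.bddAbove_image (by fun_prop)
  have hmem : x ∈ (fun u => u * x - Λ u) '' Icc um up :=
    ⟨1, Ioo_subset_Icc_self h1, by simp [hΛ1]⟩
  have hge : x ≤ Λstar x := by
    rw [hΛstar]
    exact le_csSup hbdd hmem
  refine ⟨hbdd, hge, ?_⟩
  rw [hderiv.deriv]
  constructor
  · intro h
    have hmax : IsLocalMax (fun u => u * x - Λ u) 1 := by
      filter_upwards [Icc_mem_nhds h1.1 h1.2] with u hu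
      have : u * x - Λ u ≤ Λstar x := by
        rw [hΛstar]
        exact le_csSup hbdd ⟨u, hu, rfl⟩
      simpa [hΛ1, h] using this
    have := hmax.hasDerivAt_eq_zero (((hasDerivAt_id (1 : ℝ)).mul_const x).sub hderiv)
    linarith
  · rintro rfl
    refine le_antisymm ?_ hge
    rw [hΛstar]
    refine csSup_le ⟨_, hmem⟩ ?_
    rintro _ ⟨u, hu, rfl⟩
    have := htangent u hu
    simp only
    linarith
end

section
/- Assume |ρ| < 1, b > 0, χ(0) ≤ 0 and χ(1) > 0, and define Λ*(x) := sup_{u ∈ [u_−, 1]} ( u·x − Λ(u) ) and Λ'_−(1) := −2bρ/√α + b/(2χ(1)) + a/2 (which equals the limit of Λ'(u) as u increases to 1). Then for every x ≥ Λ'_−(1), the supremum is finite and Λ*(x) = x + (2b/α)·χ(1). -/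
open Real Set

/-- A real quadratic with nonpositive leading coefficient that is nonnegative at the endpoints
of an interval is nonnegative on it. -/
lemma quadratic_nonneg_of_endpoints {A B C p r u : ℝ} (hA : A ≤ 0)
    (hp : 0 ≤ A * p ^ 2 + B * p + C) (hr : 0 ≤ A * r ^ 2 + B * r + C)
    (hpu : p ≤ u) (hur : u ≤ r) : 0 ≤ A * u ^ 2 + B * u + C := by
  rcases hpu.eq_or_lt with rfl | hpu'
  · exact hp
  have h : (r - p) * (A * u ^ 2 + B * u + C) =
      (r - u) * (A * p ^ 2 + B * p + C) + (u - p) * (A * r ^ 2 + B * r + C)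
        + -A * ((u - p) * (r - u) * (r - p)) := by ring
  have h₁ : 0 ≤ r - u := by linarith
  have h₂ : 0 ≤ u - p := by linarith
  have h₃ : 0 < r - p := by linarith
  have h₄ : 0 ≤ -A := by linarith
  refine nonneg_of_mul_nonneg_right ?_ h₃
  rw [h]
  positivity

/-- The lower root lies in `(-∞, 0]` and annihilates the quadratic under the square root. -/
lemma lower_root_spec {β ρ s um : ℝ} (hs : 0 < s) (hρ : |ρ| < 1)
    (hum : um = (2 * β * ρ + s - √((2 * β * ρ + s) ^ 2 + 4 * β ^ 2 * (1 - ρ ^ 2)))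
      / (2 * s * (1 - ρ ^ 2))) :
    um ≤ 0 ∧ (β + um * ρ * s) ^ 2 + s ^ 2 * um * (1 - um) = 0 := by
  have hρ2 : 0 < 1 - ρ ^ 2 := by
    have := (sq_lt_one_iff_abs_lt_one ρ).2 hρ
    linarith
  have hD : 0 ≤ (2 * β * ρ + s) ^ 2 + 4 * β ^ 2 * (1 - ρ ^ 2) := by positivity
  have hsq := Real.sq_sqrt hD
  have hle : 2 * β * ρ + s ≤ √((2 * β * ρ + s) ^ 2 + 4 * β ^ 2 * (1 - ρ ^ 2)) := by
    apply Real.le_sqrt_of_sq_le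
    nlinarith [mul_nonneg (sq_nonneg β) hρ2.le]
  set d := √((2 * β * ρ + s) ^ 2 + 4 * β ^ 2 * (1 - ρ ^ 2))
  constructor
  · rw [hum]
    exact div_nonpos_of_nonpos_of_nonneg (by linarith) (by positivity)
  · have hd : d = 2 * β * ρ + s - um * (2 * s * (1 - ρ ^ 2)) := by
      rw [hum]
      field_simp
      ring
    rw [hd] at hsq
    have : (4 * (1 - ρ ^ 2)) * ((β + um * ρ * s) ^ 2 + s ^ 2 * um * (1 - um)) = 0 := by
      linear_combination -hsq
    exact (mul_eq_zero.1 this).resolve_left (by positivity)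

/-- The square root of the quadratic lies below its tangent line at `1`. -/
lemma sqrt_quadratic_le_tangent {β ρ s um u : ℝ} (hs : 0 < s) (hρ : |ρ| < 1)
    (hc : 0 < β + ρ * s) (hum : (β + um * ρ * s) ^ 2 + s ^ 2 * um * (1 - um) = 0)
    (hu : um ≤ u) (hu1 : u ≤ 1) :
    √((β + u * ρ * s) ^ 2 + s ^ 2 * u * (1 - u)) ≤
      β + ρ * s + (1 - u) * (s ^ 2 / (2 * (β + ρ * s)) - ρ * s) := by
  have hρ2 : 0 < 1 - ρ ^ 2 := by
    have := (sq_lt_one_iff_abs_lt_one ρ).2 hρ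
    linarith
  have hq : ∀ w, um ≤ w → w ≤ 1 → 0 ≤ (β + w * ρ * s) ^ 2 + s ^ 2 * w * (1 - w) := by
    intro w hw hw1
    have := quadratic_nonneg_of_endpoints (A := -(s ^ 2 * (1 - ρ ^ 2)))
      (B := 2 * β * ρ * s + s ^ 2) (C := β ^ 2) (p := um) (r := 1) (u := w)
      (by have : 0 ≤ s ^ 2 * (1 - ρ ^ 2) := by positivity
          linarith) (by linear_combination hum.ge)
      (by nlinarith [sq_nonneg (β + ρ * s)]) hw hw1
    linear_combination this
  obtain ⟨c, hc'⟩ : ∃ c, c = β + ρ * s := ⟨_, rfl⟩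
  have hβ : β = c - ρ * s := by linarith
  rw [← hc'] at hc ⊢
  obtain ⟨r, hr⟩ : ∃ r, r = s / (2 * c) := ⟨_, rfl⟩
  have hsr : s ^ 2 / (2 * c) = s * r := by rw [hr]; ring
  have hrc : 2 * c * r = s := by rw [hr]; field_simp
  rw [hsr]
  have hgap : ∀ w, (c + (1 - w) * (s * r - ρ * s)) ^ 2 =
      (β + w * ρ * s) ^ 2 + s ^ 2 * w * (1 - w)
        + (1 - w) ^ 2 * (s ^ 2 * ((r - ρ) ^ 2 + (1 - ρ ^ 2))) := by
    intro w
    rw [hβ]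
    linear_combination (1 - w) * s * hrc
  have hpos : 0 < s ^ 2 * ((r - ρ) ^ 2 + (1 - ρ ^ 2)) := by positivity
  apply Real.sqrt_le_iff.2
  refine ⟨?_, ?_⟩
  · by_contra! hneg
    have hm : s * r - ρ * s < 0 := by
      by_contra! h
      nlinarith [mul_nonneg (sub_nonneg.2 hu1) h]
    obtain ⟨t, ht⟩ : ∃ t, t = c / -(s * r - ρ * s) := ⟨_, rfl⟩
    have htm : c + t * (s * r - ρ * s) = 0 := by
      rw [ht, div_neg, neg_mul, div_mul_cancel₀ _ hm.ne, add_neg_cancel]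
    have ht0 : 0 < t := by rw [ht]; exact div_pos hc (by linarith)
    have htu : t ≤ 1 - u := by
      by_contra! h
      nlinarith
    have h₁ := hgap (1 - t)
    have h₂ := hq (1 - t) (by linarith) (by linarith)
    have h₃ : 0 < t ^ 2 * (s ^ 2 * ((r - ρ) ^ 2 + (1 - ρ ^ 2))) := by positivity
    rw [sub_sub_cancel, htm] at h₁
    rw [sub_sub_cancel] at h₂
    linarith
  · rw [hgap u]
    have := mul_nonneg (sq_nonneg (1 - u)) hpos.le
    linarith

/-- with |ρ| < 1, b > 0, χ(0) ≤ 0 and χ(1) > 0, for every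
x ≥ Λ'₋(1) = −2bρ/√α + b/(2χ(1)) + a/2, the Fenchel–Legendre transform over
[u₋,1] is finite and Λ*(x) = x + (2b/α)χ(1). -/
theorem rate_function_linear_right_wing
    (a b α β ρ v : ℝ) (ha : 0 ≤ a) (hb : 0 < b) (hα : 0 < α) (hρ : |ρ| < 1) (hv : 0 < v)
    (χ γ Λ : ℝ → ℝ) (um : ℝ) (Λstar : ℝ → ℝ) (Λp1 : ℝ)
    (hχ : ∀ u, χ u = β + u * ρ * Real.sqrt α)
    (hγ : ∀ u, γ u = Real.sqrt (χ u ^ 2 + α * u * (1 - u)))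
    (hΛ : ∀ u, Λ u = -(b / α) * (χ u + γ u) + (a / 2) * u * (u - 1))
    (hum : um = (2 * β * ρ + Real.sqrt α
        - Real.sqrt ((2 * β * ρ + Real.sqrt α) ^ 2 + 4 * β ^ 2 * (1 - ρ ^ 2)))
        / (2 * Real.sqrt α * (1 - ρ ^ 2)))
    (hχ0 : χ 0 ≤ 0) (hχ1 : 0 < χ 1)
    (hΛp1 : Λp1 = -2 * b * ρ / Real.sqrt α + b / (2 * χ 1) + a / 2)
    (hΛstar : ∀ x, Λstar x = sSup ((fun u => u * x - Λ u) '' Set.Icc um 1)) :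
    ∀ x : ℝ, Λp1 ≤ x →
      BddAbove ((fun u => u * x - Λ u) '' Set.Icc um 1) ∧
      Λstar x = x + (2 * b / α) * χ 1 := by
  intro x hx
  obtain ⟨s, hs'⟩ : ∃ s, s = √α := ⟨_, rfl⟩
  have hs : 0 < s := hs' ▸ Real.sqrt_pos.2 hα
  have hαs : α = s ^ 2 := by rw [hs', Real.sq_sqrt hα.le]
  simp only [← hs'] at hχ hum hΛp1
  subst hαs
  obtain ⟨hum0, hroot⟩ := lower_root_spec hs hρ hum
  have hχ1' : χ 1 = β + ρ * s := by rw [hχ]; ring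
  rw [hχ1'] at hχ1 hΛp1 ⊢
  have hΛ1 : Λ 1 = -(2 * b / s ^ 2 * (β + ρ * s)) := by
    have hγ1 : γ 1 = β + ρ * s := by
      rw [hγ, hχ1', sub_self, mul_zero, add_zero, Real.sqrt_sq hχ1.le]
    rw [hΛ, hγ1, hχ1']
    ring
  have hgreatest : IsGreatest ((fun u => u * x - Λ u) '' Set.Icc um 1)
      (x + (2 * b / s ^ 2) * (β + ρ * s)) := by
    refine ⟨⟨1, ⟨by linarith, le_rfl⟩, ?_⟩, ?_⟩
    · simp only [hΛ1]
      ring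
    · rintro _ ⟨u, ⟨hu, hu1⟩, rfl⟩
      have htan := sqrt_quadratic_le_tangent hs hρ hχ1 hroot hu hu1
      rw [← hχ, ← hγ] at htan
      have hmul := mul_le_mul_of_nonneg_left htan (by positivity : 0 ≤ b / s ^ 2)
      have hslope := mul_le_mul_of_nonneg_left hx (sub_nonneg.2 hu1)
      have hquad : 0 ≤ a / 2 * (1 - u) ^ 2 := by positivity
      have hid : b / s ^ 2 * (χ u + (β + ρ * s
            + (1 - u) * (s ^ 2 / (2 * (β + ρ * s)) - ρ * s)))
          = 2 * b / s ^ 2 * (β + ρ * s) + (1 - u) * (Λp1 - a / 2) := by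
        rw [hΛp1, hχ]
        field_simp
        ring
      simp only [hΛ]
      linarith
  exact ⟨hgreatest.bddAbove, by rw [hΛstar, hgreatest.csSup_eq]⟩
end

section
/- Assume |ρ| < 1, b > 0, χ(0) > 0 and χ(1) ≤ 0, and define Λ*(x) := sup_{u ∈ [0, u_+]} ( u·x − Λ(u) ) and Λ'_+(0) := −2bρ/√α − b/(2β) − a/2 (which equals the limit of Λ'(u) as u decreases to 0; note χ(0) = β > 0). Then for every x ≤ Λ'_+(0), the supremum is finite and Λ*(x) = 2bβ/α. -/
open Real Set

/-- A root `U` of `u ↦ s² r u² - s m u - β²` with `r ≥ 0` bounds an interval on which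
`β² + s m u` is nonnegative. -/
lemma sq_add_mul_nonneg_of_root {β s m r U u : ℝ} (hr : 0 ≤ r)
    (hU : s ^ 2 * r * U ^ 2 - s * m * U - β ^ 2 = 0) (hu : u ∈ Icc 0 U) :
    0 ≤ β ^ 2 + s * m * u := by
  obtain ⟨h0, h1⟩ := hu
  rcases le_total 0 (s * m) with h | h
  · positivity
  · have h2 : s * m * U ≤ s * m * u := mul_le_mul_of_nonpos_left h1 h
    have h3 : 0 ≤ s ^ 2 * r * U ^ 2 := by positivity
    linarith

/-- The square root of a concave quadratic lies below its tangent at `0`. -/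
lemma sqrt_quadratic_le_tangent_s12 {β c k u : ℝ} (hβ : 0 < β) (hk : 0 ≤ k)
    (h : 0 ≤ β ^ 2 + c * u) :
    √(β ^ 2 + c * u - k * u ^ 2) ≤ β + c * u / (2 * β) := by
  have hT : 0 ≤ β + c * u / (2 * β) := by
    have e : β + c * u / (2 * β) = (β ^ 2 + (β ^ 2 + c * u)) / (2 * β) := by
      field_simp
      ring
    rw [e]
    positivity
  refine Real.sqrt_le_iff.2 ⟨hT, ?_⟩
  have e : (β + c * u / (2 * β)) ^ 2 = β ^ 2 + c * u + (c * u / (2 * β)) ^ 2 := by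
    field_simp
    ring
  rw [e]
  nlinarith [sq_nonneg (c * u / (2 * β)), mul_nonneg hk (sq_nonneg u)]

/-- with |ρ| < 1, b > 0, χ(0) > 0 and χ(1) ≤ 0, for every
x ≤ Λ'₊(0) = −2bρ/√α − b/(2β) − a/2, the Fenchel–Legendre transform over
[0,u₊] is finite and Λ*(x) = 2bβ/α. -/
theorem rate_function_constant_left_wing
    (a b α β ρ v : ℝ) (ha : 0 ≤ a) (hb : 0 < b) (hα : 0 < α) (hρ : |ρ| < 1) (hv : 0 < v)
    (χ γ Λ : ℝ → ℝ) (up : ℝ) (Λstar : ℝ → ℝ) (Λp0 : ℝ)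
    (hχ : ∀ u, χ u = β + u * ρ * Real.sqrt α)
    (hγ : ∀ u, γ u = Real.sqrt (χ u ^ 2 + α * u * (1 - u)))
    (hΛ : ∀ u, Λ u = -(b / α) * (χ u + γ u) + (a / 2) * u * (u - 1))
    (hup : up = (2 * β * ρ + Real.sqrt α
        + Real.sqrt ((2 * β * ρ + Real.sqrt α) ^ 2 + 4 * β ^ 2 * (1 - ρ ^ 2)))
        / (2 * Real.sqrt α * (1 - ρ ^ 2)))
    (hχ0 : 0 < χ 0) (hχ1 : χ 1 ≤ 0)
    (hΛp0 : Λp0 = -2 * b * ρ / Real.sqrt α - b / (2 * β) - a / 2)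
    (hΛstar : ∀ x, Λstar x = sSup ((fun u => u * x - Λ u) '' Set.Icc (0 : ℝ) up)) :
    ∀ x : ℝ, x ≤ Λp0 →
      BddAbove ((fun u => u * x - Λ u) '' Set.Icc (0 : ℝ) up) ∧
      Λstar x = 2 * b * β / α := by
  intro x hx
  have hβ : 0 < β := by simpa [hχ] using hχ0
  have hs : 0 < √α := Real.sqrt_pos.2 hα
  have hss : √α ^ 2 = α := Real.sq_sqrt hα.le
  have hr : 0 < 1 - ρ ^ 2 := by
    have := (sq_lt_one_iff_abs_lt_one ρ).2 hρ
    linarith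
  set s := √α
  set m := 2 * β * ρ + s with hm
  have hD : 0 ≤ m ^ 2 + 4 * β ^ 2 * (1 - ρ ^ 2) := by positivity
  have hw := Real.sq_sqrt hD
  set w := √(m ^ 2 + 4 * β ^ 2 * (1 - ρ ^ 2))
  have hroot : s ^ 2 * (1 - ρ ^ 2) * up ^ 2 - s * m * up - β ^ 2 = 0 := by
    rw [hup]
    generalize 1 - ρ ^ 2 = r at *
    field_simp
    linear_combination hw
  have hup0 : 0 ≤ up := by
    have h1 : |m| ≤ w := Real.abs_le_sqrt (by nlinarith [mul_nonneg (sq_nonneg β) hr.le])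
    have h2 : 0 ≤ m + w := by linarith [neg_abs_le m]
    rw [hup]
    positivity
  have h0 : 0 * x - Λ 0 = 2 * b * β / α := by
    simp only [hΛ, hγ, hχ]
    simp [Real.sqrt_sq hβ.le]
    ring
  have hle : ∀ u ∈ Icc (0 : ℝ) up, u * x - Λ u ≤ 2 * b * β / α := by
    intro u hu
    have hγT := sqrt_quadratic_le_tangent_s12 hβ (k := s ^ 2 * (1 - ρ ^ 2)) (by positivity)
      (sq_add_mul_nonneg_of_root hr.le hroot hu)
    have hγu : γ u ≤ β + s * m * u / (2 * β) := by
      rw [hγ, hχ]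
      convert hγT using 2
      rw [← hss, hm]
      ring
    have hux : u * x ≤ u * Λp0 := mul_le_mul_of_nonneg_left hx hu.1
    have hbγ : b / α * γ u ≤ b / α * (β + s * m * u / (2 * β)) :=
      mul_le_mul_of_nonneg_left hγu (by positivity)
    have hau : 0 ≤ a / 2 * u ^ 2 := by positivity
    have key : u * Λp0 + b / α * (χ u + (β + s * m * u / (2 * β))) + a / 2 * u
        = 2 * b * β / α := by
      rw [hΛp0, hχ, hm, ← hss]
      field_simp
      ring
    rw [hΛ]
    linarith
  have hgr : IsGreatest ((fun u => u * x - Λ u) '' Icc (0 : ℝ) up) (2 * b * β / α) :=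
    ⟨⟨0, ⟨le_rfl, hup0⟩, h0⟩, forall_mem_image.2 hle⟩
  exact ⟨hgr.bddAbove, by rw [hΛstar, hgr.csSup_eq]⟩
end

section
/- Assume a = 0, b > 0 and |ρ| < 1. For every x ∈ ℝ, the point u_x := (1/(2(1−ρ²)√α))·( 2ρβ + √α + p(x)·ξ/√(p(x)² + b²(1−ρ²)) ), where p(x) := bρ + x√α and ξ := √((2ρβ+√α)² + 4β²(1−ρ²)), lies in the open interval (u_−, u_+) and is the unique u ∈ (u_−, u_+) at which the derivative of Λ satisfies Λ'(u) = x. -/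
open Real Set

/-- A point `w` of `(-ξ, ξ)`, with `g > 0` half the height of the ellipse `w² + 4kg² = ξ²` over it,
lies on the line `b w = 2 p g` exactly when `w = p ξ / √(p² + b² k)`. -/
lemma line_meets_ellipse_iff {b k p ξ w g : ℝ} (hb : 0 < b) (hk : 0 < k) (hξ : 0 < ξ) (hg : 0 < g)
    (h : 4 * k * g ^ 2 = ξ ^ 2 - w ^ 2) :
    b * w = 2 * p * g ↔ w = p * ξ / √(p ^ 2 + b ^ 2 * k) := by
  have hq : 0 < √(p ^ 2 + b ^ 2 * k) := by positivity
  have hq2 : √(p ^ 2 + b ^ 2 * k) ^ 2 = p ^ 2 + b ^ 2 * k := sq_sqrt (by positivity)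
  set q := √(p ^ 2 + b ^ 2 * k)
  rw [eq_div_iff hq.ne']
  constructor
  · intro hw
    have hgq : 2 * g * q = b * ξ := by
      refine (sq_eq_sq₀ (by positivity) (by positivity)).mp ?_
      linear_combination 4 * g ^ 2 * hq2 + b ^ 2 * h - (b * w + 2 * p * g) * hw
    refine mul_left_cancel₀ hb.ne' ?_
    linear_combination q * hw + p * hgq
  · intro hw
    have hgq : 2 * g * q = b * ξ := by
      refine (sq_eq_sq₀ (by positivity) (by positivity)).mp ?_
      refine mul_left_cancel₀ hk.ne' ?_
      linear_combination q ^ 2 * h + ξ ^ 2 * hq2 - (w * q + p * ξ) * hw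
    refine mul_right_cancel₀ hq.ne' ?_
    linear_combination b * hw - p * hgq

/-- The factor `p / √(p² + c)` has absolute value less than one. -/
lemma abs_mul_div_sqrt_sq_add_lt {p c ξ : ℝ} (hc : 0 < c) (hξ : 0 < ξ) :
    |p * ξ / √(p ^ 2 + c)| < ξ := by
  have hq : 0 < √(p ^ 2 + c) := by positivity
  rw [abs_div, abs_mul, abs_of_pos hξ, abs_of_pos hq, div_lt_iff₀ hq, mul_comm]
  refine mul_lt_mul_of_pos_left ?_ hξ
  rw [← sqrt_sq_eq_abs]
  exact sqrt_lt_sqrt (sq_nonneg p) (by linarith)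

/-- for a = 0, b > 0 and |ρ| < 1, the explicit point u_x lies in
(u₋, u₊) and is the unique solution there of Λ'(u) = x. -/
theorem saddlepoint_explicit
    (b α β ρ v : ℝ) (hb : 0 < b) (hα : 0 < α) (hρ : |ρ| < 1) (hv : 0 < v)
    (χ γ Λ : ℝ → ℝ) (um up : ℝ)
    (hχ : ∀ u, χ u = β + u * ρ * Real.sqrt α)
    (hγ : ∀ u, γ u = Real.sqrt (χ u ^ 2 + α * u * (1 - u)))
    (hΛ : ∀ u, Λ u = -(b / α) * (χ u + γ u))
    (hum : um = (2 * β * ρ + Real.sqrt α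
        - Real.sqrt ((2 * β * ρ + Real.sqrt α) ^ 2 + 4 * β ^ 2 * (1 - ρ ^ 2)))
        / (2 * Real.sqrt α * (1 - ρ ^ 2)))
    (hup : up = (2 * β * ρ + Real.sqrt α
        + Real.sqrt ((2 * β * ρ + Real.sqrt α) ^ 2 + 4 * β ^ 2 * (1 - ρ ^ 2)))
        / (2 * Real.sqrt α * (1 - ρ ^ 2)))
    (x : ℝ) (p ξ ux : ℝ)
    (hp : p = b * ρ + x * Real.sqrt α)
    (hξ : ξ = Real.sqrt ((2 * ρ * β + Real.sqrt α) ^ 2 + 4 * β ^ 2 * (1 - ρ ^ 2)))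
    (hux : ux = (1 / (2 * (1 - ρ ^ 2) * Real.sqrt α))
        * (2 * ρ * β + Real.sqrt α + p * ξ / Real.sqrt (p ^ 2 + b ^ 2 * (1 - ρ ^ 2)))) :
    ux ∈ Set.Ioo um up ∧ deriv Λ ux = x ∧
      ∀ u ∈ Set.Ioo um up, deriv Λ u = x → u = ux := by
  have hs : 0 < √α := sqrt_pos.mpr hα
  have hsα : √α ^ 2 = α := sq_sqrt hα.le
  set s := √α
  have hk : 0 < 1 - ρ ^ 2 := by linarith [(sq_lt_one_iff_abs_lt_one ρ).mpr hρ]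
  have hrad : 0 < (2 * ρ * β + s) ^ 2 + 4 * β ^ 2 * (1 - ρ ^ 2) := by
    rcases eq_or_ne β 0 with rfl | hβ
    · simpa using pow_pos hs 2
    · positivity
  have hξ0 : 0 < ξ := hξ ▸ sqrt_pos.mpr hrad
  have hξ2 : ξ ^ 2 = (2 * ρ * β + s) ^ 2 + 4 * β ^ 2 * (1 - ρ ^ 2) := by
    rw [hξ, sq_sqrt hrad.le]
  rw [show 2 * β * ρ = 2 * ρ * β by ring, ← hξ] at hum hup
  set k := 1 - ρ ^ 2 with hkdef
  have hmem : ∀ u, u ∈ Ioo um up ↔ |2 * s * k * u - (2 * ρ * β + s)| < ξ := by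
    intro u
    have h2 : 0 < 2 * s * k := by positivity
    rw [mem_Ioo, hum, hup, div_lt_iff₀ h2, lt_div_iff₀ h2, abs_lt]
    constructor <;> rintro ⟨h₁, h₂⟩ <;> constructor <;> linarith
  have hquad : ∀ u, 4 * k * (χ u ^ 2 + α * u * (1 - u))
      = ξ ^ 2 - (2 * s * k * u - (2 * ρ * β + s)) ^ 2 := by
    intro u
    rw [hχ, hξ2, ← hsα, hkdef]
    ring
  have hpos : ∀ u ∈ Ioo um up, 0 < χ u ^ 2 + α * u * (1 - u) := by
    intro u hu
    have h : 0 < 4 * k * (χ u ^ 2 + α * u * (1 - u)) := by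
      rw [hquad]
      exact sub_pos.mpr (sq_lt_sq.mpr (by rw [abs_of_pos hξ0]; exact (hmem u).mp hu))
    exact pos_of_mul_pos_right h (by positivity)
  have hderiv : ∀ u ∈ Ioo um up, deriv Λ u
      = -(b / α) * (ρ * s - s * (2 * s * k * u - (2 * ρ * β + s)) / (2 * γ u)) := by
    intro u hu
    have hdχ : HasDerivAt χ (ρ * s) u := by
      rw [funext hχ]
      simpa using (((hasDerivAt_id u).mul_const ρ).mul_const s).const_add β
    have hdγ : HasDerivAt γ (-(s * (2 * s * k * u - (2 * ρ * β + s))) / (2 * γ u)) u := by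
      have hdD : HasDerivAt (fun u => χ u ^ 2 + α * u * (1 - u))
          (-(s * (2 * s * k * u - (2 * ρ * β + s)))) u := by
        refine ((hdχ.pow 2).add (((hasDerivAt_id u).const_mul α).mul
          ((hasDerivAt_id u).const_sub 1))).congr_deriv ?_
        rw [hχ, ← hsα, hkdef]
        simp
        ring
      rw [hγ u, funext hγ]
      exact hdD.sqrt (hpos u hu).ne'
    rw [funext hΛ]
    refine ((hdχ.add hdγ).const_mul (-(b / α))).deriv.trans ?_
    ring
  have hsaddle : ∀ u ∈ Ioo um up, (deriv Λ u = x ↔ u = ux) := by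
    intro u hu
    have hγ0 : 0 < γ u := hγ u ▸ sqrt_pos.mpr (hpos u hu)
    have hγ2 : 4 * k * γ u ^ 2 = ξ ^ 2 - (2 * s * k * u - (2 * ρ * β + s)) ^ 2 := by
      rw [hγ, sq_sqrt (hpos u hu).le, hquad]
    have hline : deriv Λ u = x ↔
        b * (2 * s * k * u - (2 * ρ * β + s)) = 2 * p * γ u := by
      rw [hderiv u hu, hp, ← hsα]
      field_simp
      constructor <;> intro h <;> linarith
    rw [hline, line_meets_ellipse_iff hb hk hξ0 hγ0 hγ2, hux, sub_eq_iff_eq_add, one_div,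
      eq_inv_mul_iff_mul_eq₀ (by positivity), mul_right_comm 2 s k, add_comm]
  have huxm : ux ∈ Ioo um up := by
    rw [hmem]
    have hw : 2 * s * k * ux - (2 * ρ * β + s) = p * ξ / √(p ^ 2 + b ^ 2 * k) := by
      rw [hux]
      field_simp
      ring
    rw [hw]
    exact abs_mul_div_sqrt_sq_add_lt (by positivity) hξ0
  exact ⟨huxm, (hsaddle ux huxm).mpr rfl, fun u hu => (hsaddle u hu).mp⟩
end

section
/- Assume a = 0, b > 0, |ρ| < 1, χ(0) < 0 and χ(1) < 0. Then for every x ∈ ℝ, sup_{u ∈ [u_−, u_+]} ( u·x − Λ(u) ) = x·u_x − Λ(u_x), where u_x := (1/(2(1−ρ²)√α))·( 2ρβ + √α + p(x)·ξ/√(p(x)² + b²(1−ρ²)) ), with p(x) := bρ + x√α and ξ := √((2ρβ+√α)² + 4β²(1−ρ²)). -/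
open Real Set

/-- The support function of the upper half circle of radius `h`, in the direction `(p, q)`. -/
theorem isMaxOn_mul_add_mul_sqrt_sq_sub_sq {p q h : ℝ} (hq : 0 < q) (hh : 0 ≤ h) :
    p * h / √(p ^ 2 + q ^ 2) ∈ Icc (-h) h ∧
      IsMaxOn (fun w => p * w + q * √(h ^ 2 - w ^ 2)) (Icc (-h) h)
        (p * h / √(p ^ 2 + q ^ 2)) := by
  have hpos : 0 < p ^ 2 + q ^ 2 := by positivity
  obtain ⟨d, hd⟩ : ∃ d, d = √(p ^ 2 + q ^ 2) := ⟨_, rfl⟩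
  have hd0 : 0 < d := hd ▸ sqrt_pos.2 hpos
  have hd2 : d ^ 2 = p ^ 2 + q ^ 2 := by rw [hd, sq_sqrt hpos.le]
  rw [← hd]
  constructor
  · obtain ⟨h1, h2⟩ := abs_le.1 (abs_le_of_sq_le_sq (by nlinarith [sq_nonneg q]) hd0.le : |p| ≤ d)
    rw [mem_Icc, le_div_iff₀ hd0, div_le_iff₀ hd0]
    constructor <;> nlinarith
  · intro w hw
    have hmax : p * (p * h / d) + q * √(h ^ 2 - (p * h / d) ^ 2) = h * d := by
      have hsq : h ^ 2 - (p * h / d) ^ 2 = (q * h / d) ^ 2 := by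
        field_simp
        linear_combination h ^ 2 * hd2
      rw [hsq, sqrt_sq (by positivity)]
      field_simp
      linear_combination -h * hd2
    have hg := sq_sqrt (by nlinarith [hw.1, hw.2] : 0 ≤ h ^ 2 - w ^ 2)
    simp only [mem_ofPred_eq, hmax]
    refine le_of_abs_le (abs_le_of_sq_le_sq ?_ (by positivity))
    have := sq_nonneg (p * √(h ^ 2 - w ^ 2) - q * w)
    linear_combination this - h ^ 2 * hd2 + (p ^ 2 + q ^ 2) * hg

/-- for a = 0, b > 0, |ρ| < 1, χ(0) < 0 and χ(1) < 0, the
Fenchel–Legendre supremum over [u₋, u₊] is attained at the explicit point u_x: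
sup_{u ∈ [u₋,u₊]} (ux − Λ(u)) = x·u_x − Λ(u_x). -/
theorem rate_function_explicit
    (b α β ρ v : ℝ) (hb : 0 < b) (hα : 0 < α) (hρ : |ρ| < 1) (hv : 0 < v)
    (χ γ Λ : ℝ → ℝ) (um up : ℝ)
    (hχ : ∀ u, χ u = β + u * ρ * Real.sqrt α)
    (hγ : ∀ u, γ u = Real.sqrt (χ u ^ 2 + α * u * (1 - u)))
    (hΛ : ∀ u, Λ u = -(b / α) * (χ u + γ u))
    (hum : um = (2 * β * ρ + Real.sqrt α
        - Real.sqrt ((2 * β * ρ + Real.sqrt α) ^ 2 + 4 * β ^ 2 * (1 - ρ ^ 2)))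
        / (2 * Real.sqrt α * (1 - ρ ^ 2)))
    (hup : up = (2 * β * ρ + Real.sqrt α
        + Real.sqrt ((2 * β * ρ + Real.sqrt α) ^ 2 + 4 * β ^ 2 * (1 - ρ ^ 2)))
        / (2 * Real.sqrt α * (1 - ρ ^ 2)))
    (hχ0 : χ 0 < 0) (hχ1 : χ 1 < 0)
    (x : ℝ) (p ξ ux : ℝ)
    (hp : p = b * ρ + x * Real.sqrt α)
    (hξ : ξ = Real.sqrt ((2 * ρ * β + Real.sqrt α) ^ 2 + 4 * β ^ 2 * (1 - ρ ^ 2)))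
    (hux : ux = (1 / (2 * (1 - ρ ^ 2) * Real.sqrt α))
        * (2 * ρ * β + Real.sqrt α + p * ξ / Real.sqrt (p ^ 2 + b ^ 2 * (1 - ρ ^ 2)))) :
    sSup ((fun u => u * x - Λ u) '' Set.Icc um up) = x * ux - Λ ux := by
  have hs : 0 < √α := sqrt_pos.2 hα
  have hr : 0 < 1 - ρ ^ 2 := sub_pos.2 ((sq_lt_one_iff_abs_lt_one ρ).2 hρ)
  obtain ⟨k, hk⟩ : ∃ k, k = √(1 - ρ ^ 2) := ⟨_, rfl⟩
  have hk0 : 0 < k := hk ▸ sqrt_pos.2 hr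
  have hk2 : 1 - ρ ^ 2 = k ^ 2 := by rw [hk, sq_sqrt hr.le]
  have hξ0 : 0 ≤ ξ := hξ ▸ sqrt_nonneg _
  have hξ2 : ξ ^ 2 = (2 * ρ * β + √α) ^ 2 + 4 * β ^ 2 * k ^ 2 := by
    rw [hξ, sq_sqrt (by positivity), hk2]
  rw [show 2 * β * ρ = 2 * ρ * β by ring, ← hξ] at hum hup
  rw [hk2] at hum hup hux
  obtain ⟨s, hsdef⟩ : ∃ s, s = √α := ⟨_, rfl⟩
  have hα2 : α = s ^ 2 := by rw [hsdef, sq_sqrt hα.le]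
  rw [← hsdef] at hs hξ2 hum hup hux hp
  simp only [← hsdef] at hχ
  obtain ⟨c, hc⟩ : ∃ c, c = (2 * ρ * β + s) / (2 * s * k ^ 2) := ⟨_, rfl⟩
  obtain ⟨h, hh⟩ : ∃ h, h = ξ / (2 * s * k ^ 2) := ⟨_, rfl⟩
  have hh0 : 0 ≤ h := by rw [hh]; positivity
  obtain ⟨hmem, hmax⟩ := isMaxOn_mul_add_mul_sqrt_sq_sub_sq (p := p) (mul_pos hb hk0) hh0
  rw [mul_pow] at hmem hmax
  obtain ⟨w₀, hw₀⟩ : ∃ w, w = p * h / √(p ^ 2 + b ^ 2 * k ^ 2) := ⟨_, rfl⟩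
  rw [← hw₀] at hmem hmax
  have hux' : ux = c + w₀ := by
    rw [hux, hw₀, hc, hh]
    field_simp
  have hum' : um = c - h := by rw [hum, hc, hh]; ring
  have hup' : up = c + h := by rw [hup, hc, hh]; ring
  have hγ' : ∀ u, γ u = s * k * √(h ^ 2 - (u - c) ^ 2) := by
    intro u
    have hquad : χ u ^ 2 + α * u * (1 - u) = (s * k) ^ 2 * (h ^ 2 - (u - c) ^ 2) := by
      rw [hχ, hα2, hh, hc]
      field_simp
      rw [hξ2]
      linear_combination (-4 * k ^ 2 * s ^ 2 * u ^ 2) * hk2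
    rw [hγ, hquad, sqrt_mul (sq_nonneg _), sqrt_sq (by positivity)]
  have hobj : ∀ u, u * x - Λ u = (b * β / α + p * c / s)
      + (p * (u - c) + b * k * √(h ^ 2 - (u - c) ^ 2)) / s := by
    intro u
    rw [hΛ, hγ', hχ, hp, hα2]
    field_simp
    ring
  refine IsGreatest.csSup_eq ⟨⟨ux, ?_, by ring⟩, ?_⟩
  · rw [hux', hum', hup']
    constructor <;> linarith [hmem.1, hmem.2]
  · rintro _ ⟨u, ⟨hu1, hu2⟩, rfl⟩
    have hle := hmax (show u - c ∈ Icc (-h) h by constructor <;> linarith)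
    simp only [mem_ofPred_eq] at hle
    simp only [mul_comm x, hobj, hux', add_sub_cancel_left]
    gcongr
end

section
/- Assume a = 0, b > 0, |ρ| < 1, χ(0) ≤ 0 and χ(1) > 0. Define λ₁ := √(2bχ(1)), Λ'_−(1) := −2bρ/√α + b/(2χ(1)), and Λ*(x) := sup_{u ∈ [u_−, 1]} ( u·x − Λ(u) ). Then for every x > Λ'_−(1): λ₁² + αx > 0, Λ*(x)·(Λ*(x) − x) ≥ 0, and the limiting implied variance satisfies 2·( 2Λ*(x) − x + 2·√( Λ*(x)·(Λ*(x) − x) ) ) = 2x + (4λ₁/α)·( λ₁ + √( λ₁² + αx ) ). -/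
open Real Set

/-- A quadratic `c² + 2cd(u-1) - m(u-1)²` with `c, m > 0` that is nonnegative at some `u ≤ 1` has
its square root there bounded by its tangent line at `u = 1`. -/
theorem sqrt_quadratic_le_tangent_s16 {c d m u : ℝ} (hc : 0 < c) (hm : 0 ≤ m)
    (hq : 0 ≤ c ^ 2 + 2 * c * d * (u - 1) - m * (u - 1) ^ 2) :
    Real.sqrt (c ^ 2 + 2 * c * d * (u - 1) - m * (u - 1) ^ 2) ≤ c + d * (u - 1) := by
  have hmt : 0 ≤ m * (u - 1) ^ 2 := by positivity
  have hL : 0 ≤ c + d * (u - 1) := by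
    by_contra! h
    nlinarith [mul_pos hc (neg_pos.mpr h), sq_nonneg c, mul_pos hc hc]
  rw [Real.sqrt_le_iff]
  exact ⟨hL, by nlinarith [sq_nonneg (d * (u - 1))]⟩

/-- The quadratic `β² + s(2βρ + s)u - s²(1 - ρ²)u²` is nonnegative between its smaller root
and `0`. -/
theorem quadratic_nonneg_of_root_le {β ρ s u : ℝ} (hs : 0 < s) (hr : 0 < 1 - ρ ^ 2)
    (hu0 : u ≤ 0)
    (hu : (2 * β * ρ + s - Real.sqrt ((2 * β * ρ + s) ^ 2 + 4 * β ^ 2 * (1 - ρ ^ 2)))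
        / (2 * s * (1 - ρ ^ 2)) ≤ u) :
    0 ≤ β ^ 2 + s * (2 * β * ρ + s) * u - s ^ 2 * (1 - ρ ^ 2) * u ^ 2 := by
  have hk : 0 < 2 * s * (1 - ρ ^ 2) := by positivity
  rw [div_le_iff₀ hk] at hu
  have hD : 0 ≤ (2 * β * ρ + s) ^ 2 + 4 * β ^ 2 * (1 - ρ ^ 2) := by positivity
  have hSq := Real.sq_sqrt hD
  have hA : |2 * β * ρ + s| ≤ Real.sqrt ((2 * β * ρ + s) ^ 2 + 4 * β ^ 2 * (1 - ρ ^ 2)) := by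
    apply Real.abs_le_sqrt
    have : 0 ≤ 4 * β ^ 2 * (1 - ρ ^ 2) := by positivity
    linarith
  set S := Real.sqrt ((2 * β * ρ + s) ^ 2 + 4 * β ^ 2 * (1 - ρ ^ 2))
  have h1 : 0 ≤ S + (u * (2 * s * (1 - ρ ^ 2)) - (2 * β * ρ + s)) := by linarith
  have h2 : 0 ≤ S - (u * (2 * s * (1 - ρ ^ 2)) - (2 * β * ρ + s)) := by
    have := mul_nonneg (neg_nonneg.mpr hu0) hk.le
    linarith [(abs_le.mp hA).1]
  have h3 : 0 ≤ 4 * (1 - ρ ^ 2) *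
      (β ^ 2 + s * (2 * β * ρ + s) * u - s ^ 2 * (1 - ρ ^ 2) * u ^ 2) := by
    have := mul_nonneg h1 h2
    linear_combination this + hSq
  exact nonneg_of_mul_nonneg_right h3 (by positivity)

/-- for a = 0, b > 0, |ρ| < 1, χ(0) ≤ 0 and χ(1) > 0, with
λ₁ = √(2bχ(1)) and Λ'₋(1) = −2bρ/√α + b/(2χ(1)), for every x > Λ'₋(1) the
limiting implied variance satisfies
2(2Λ*(x) − x + 2√(Λ*(x)(Λ*(x)−x))) = 2x + (4λ₁/α)(λ₁ + √(λ₁² + αx)). -/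
theorem implied_variance_right_wing
    (b α β ρ v : ℝ) (hb : 0 < b) (hα : 0 < α) (hρ : |ρ| < 1) (hv : 0 < v)
    (χ γ Λ : ℝ → ℝ) (um : ℝ) (Λstar : ℝ → ℝ) (lam₁ Λp1 : ℝ)
    (hχ : ∀ u, χ u = β + u * ρ * Real.sqrt α)
    (hγ : ∀ u, γ u = Real.sqrt (χ u ^ 2 + α * u * (1 - u)))
    (hΛ : ∀ u, Λ u = -(b / α) * (χ u + γ u))
    (hum : um = (2 * β * ρ + Real.sqrt α
        - Real.sqrt ((2 * β * ρ + Real.sqrt α) ^ 2 + 4 * β ^ 2 * (1 - ρ ^ 2)))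
        / (2 * Real.sqrt α * (1 - ρ ^ 2)))
    (hχ0 : χ 0 ≤ 0) (hχ1 : 0 < χ 1)
    (hlam₁ : lam₁ = Real.sqrt (2 * b * χ 1))
    (hΛp1 : Λp1 = -2 * b * ρ / Real.sqrt α + b / (2 * χ 1))
    (hΛstar : ∀ x, Λstar x = sSup ((fun u => u * x - Λ u) '' Set.Icc um 1)) :
    ∀ x : ℝ, Λp1 < x →
      0 < lam₁ ^ 2 + α * x ∧
      0 ≤ Λstar x * (Λstar x - x) ∧
      2 * (2 * Λstar x - x + 2 * Real.sqrt (Λstar x * (Λstar x - x)))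
        = 2 * x + (4 * lam₁ / α) * (lam₁ + Real.sqrt (lam₁ ^ 2 + α * x)) := by
  intro x hx
  have hs : 0 < Real.sqrt α := Real.sqrt_pos.mpr hα
  have hsα : Real.sqrt α ^ 2 = α := Real.sq_sqrt hα.le
  set s := Real.sqrt α
  have hr : 0 < 1 - ρ ^ 2 := by
    have := (sq_lt_one_iff_abs_lt_one ρ).mpr hρ
    linarith
  have hβ : β ≤ 0 := by simpa [hχ] using hχ0
  have hc1 : χ 1 = β + ρ * s := by rw [hχ]; ring
  set c := χ 1
  have hlam : lam₁ ^ 2 = 2 * b * c := by rw [hlam₁]; exact Real.sq_sqrt (by positivity)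
  have hlam0 : 0 ≤ lam₁ := by rw [hlam₁]; exact Real.sqrt_nonneg _
  have hdisc : 0 < α + 4 * β * c := by
    rw [hc1, ← hsα]
    have : 0 < s ^ 2 * (1 - ρ ^ 2) := by positivity
    nlinarith [sq_nonneg (2 * β + ρ * s)]
  have hpos : 0 < lam₁ ^ 2 + α * x := by
    have h1 : lam₁ ^ 2 + α * Λp1 = b * (α + 4 * β * c) / (2 * c) := by
      rw [hlam, hΛp1, ← hsα]
      field_simp
      rw [hc1]
      ring
    have h2 : 0 < b * (α + 4 * β * c) / (2 * c) := by positivity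
    have h3 := mul_lt_mul_of_pos_left hx hα
    linarith
  have hγ1 : γ 1 = c := by
    rw [hγ, sub_self, mul_zero, add_zero]
    exact Real.sqrt_sq hχ1.le
  have hum0 : um ≤ 0 := by
    rw [hum]
    apply div_nonpos_of_nonpos_of_nonneg _ (by positivity)
    rw [sub_nonpos]
    apply Real.le_sqrt_of_sq_le
    have : 0 ≤ 4 * β ^ 2 * (1 - ρ ^ 2) := by positivity
    linarith
  have htangent : ∀ u ∈ Set.Icc um 1, γ u ≤ c + (ρ * s - α / (2 * c)) * (u - 1) := by
    rintro u ⟨hu, hu1⟩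
    have hq : 0 ≤ χ u ^ 2 + α * u * (1 - u) := by
      rcases le_total 0 u with h | h
      · have : 0 ≤ α * u * (1 - u) := mul_nonneg (by positivity) (by linarith)
        positivity
      · rw [hum] at hu
        have := quadratic_nonneg_of_root_le hs hr h hu
        rw [hχ, ← hsα]
        linear_combination this
    have he : χ u ^ 2 + α * u * (1 - u) = c ^ 2 + 2 * c * (ρ * s - α / (2 * c)) * (u - 1)
        - s ^ 2 * (1 - ρ ^ 2) * (u - 1) ^ 2 := by
      have h1 : 2 * c * (ρ * s - α / (2 * c)) = 2 * c * (ρ * s) - α := by field_simp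
      rw [h1, hχ, hc1, ← hsα]
      ring
    rw [he] at hq
    rw [hγ, he]
    exact sqrt_quadratic_le_tangent_s16 hχ1 (by positivity) hq
  have hstar : Λstar x = x + lam₁ ^ 2 / α := by
    rw [hΛstar]
    apply IsGreatest.csSup_eq
    constructor
    · refine ⟨1, ⟨by linarith, le_rfl⟩, ?_⟩
      simp only [hΛ, hγ1]
      rw [hlam]
      change 1 * x - -(b / α) * (c + c) = _
      ring
    · rintro _ ⟨u, hu, rfl⟩
      have hmul := mul_le_mul_of_nonneg_left (htangent u hu) (div_pos hb hα).le
      have hslope : Λp1 = -(b / α) * (ρ * s + (ρ * s - α / (2 * c))) := by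
        rw [hΛp1, ← hsα]
        field_simp
        ring
      have hχu : χ u = c + ρ * s * (u - 1) := by rw [hχ, hc1]; ring
      have hgap := mul_nonneg (sub_nonneg.mpr hu.2) (sub_pos.mpr hx).le
      have hval : lam₁ ^ 2 / α = b / α * (2 * c) := by rw [hlam]; ring
      simp only [hΛ]
      rw [hχu, hval]
      rw [hslope] at hgap
      linarith
  have hprod : Λstar x * (Λstar x - x) = (lam₁ / α) ^ 2 * (lam₁ ^ 2 + α * x) := by
    rw [hstar]
    field_simp
    ring
  refine ⟨hpos, ?_, ?_⟩
  · rw [hprod]; positivity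
  · rw [hprod, Real.sqrt_mul (by positivity), Real.sqrt_sq (by positivity), hstar]
    field_simp
    ring
end

section
/- Assume |ρ| < 1, b > 0, χ(0) ≤ 0 and χ(1) > 0, and suppose Λ'_−(1) := −2bρ/√α + b/(2χ(1)) + a/2 < 0 (this quantity equals the limit of Λ'(u) as u increases to 1). Then for every t > 0 there exists a unique u_t ∈ (u_−, 1) satisfying t·Λ'(u_t) + (2b/α)/(1 − u_t) = 0; moreover u_t → 1 as t → ∞, and t·(1 − u_t) → −2b/(α·Λ'_−(1)) as t → ∞. -/
open Real Set Filter Topology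

/-- If `D` is monotone and continuous on `(l, 1)`, tends to `-∞` at `l` and to `D₁ < 0` at `1`, then
`t * D u + c / (1 - u)` has a unique zero `ut t` in `(l, 1)` for each `t > 0`, and
`t * (1 - ut t) → -c / D₁` as `t → ∞`. -/
theorem exists_unique_saddlepoint_of_monotoneOn {D : ℝ → ℝ} {l c D₁ : ℝ} (hl : l < 1) (hc : 0 < c)
    (hcont : ContinuousOn D (Ioo l 1)) (hmono : MonotoneOn D (Ioo l 1))
    (hbot : Tendsto D (𝓝[>] l) atBot) (hone : Tendsto D (𝓝[<] 1) (𝓝 D₁)) (hD₁ : D₁ < 0) :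
    ∃ ut : ℝ → ℝ,
      (∀ t : ℝ, 0 < t → ut t ∈ Ioo l 1 ∧ t * D (ut t) + c / (1 - ut t) = 0 ∧
        ∀ u ∈ Ioo l 1, t * D u + c / (1 - u) = 0 → u = ut t) ∧
      Tendsto ut atTop (𝓝 1) ∧
      Tendsto (fun t => t * (1 - ut t)) atTop (𝓝 (-c / D₁)) := by
  have hstrict : ∀ t : ℝ, 0 < t → StrictMonoOn (fun u => t * D u + c / (1 - u)) (Ioo l 1) := by
    intro t ht x hx y hy hxy
    have h1 : t * D x ≤ t * D y := mul_le_mul_of_nonneg_left (hmono hx hy hxy.le) ht.le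
    have h2 : c / (1 - x) < c / (1 - y) :=
      div_lt_div_of_pos_left hc (by linarith [hy.2]) (by linarith)
    exact add_lt_add_of_le_of_lt h1 h2
  have hex : ∀ t : ℝ, 0 < t → ∃ u ∈ Ioo l 1, t * D u + c / (1 - u) = 0 := by
    intro t ht
    have hcont' : ContinuousOn (fun u => t * D u + c / (1 - u)) (Ioo l 1) := by
      refine (continuousOn_const.mul hcont).add (continuousOn_const.div (by fun_prop) ?_)
      intro u hu
      linarith [hu.2]
    have hb : Tendsto (fun u => t * D u + c / (1 - u)) (𝓝[>] l) atBot := by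
      refine Tendsto.atBot_add (C := c / (1 - l)) (hbot.const_mul_atBot ht) ?_
      have : ContinuousAt (fun u : ℝ => c / (1 - u)) l :=
        continuousAt_const.div (by fun_prop) (by linarith)
      exact this.tendsto.mono_left nhdsWithin_le_nhds
    have ha : Tendsto (fun u => t * D u + c / (1 - u)) (𝓝[<] 1) atTop := by
      refine Tendsto.add_atTop (C := t * D₁) (hone.const_mul t) ?_
      have h0 : Tendsto (fun u : ℝ => 1 - u) (𝓝[<] 1) (𝓝[>] 0) := by
        refine tendsto_nhdsWithin_iff.2 ⟨?_, ?_⟩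
        · have : ContinuousAt (fun u : ℝ => 1 - u) 1 := by fun_prop
          simpa using this.tendsto.mono_left (nhdsWithin_le_nhds (s := Iio 1))
        · filter_upwards [self_mem_nhdsWithin] with u hu
          simpa using hu
      simpa [div_eq_mul_inv] using h0.inv_tendsto_nhdsGT_zero.const_mul_atTop hc
    have hlP : 𝓝[>] l ≤ 𝓟 (Ioo l 1) := le_principal_iff.2 (Ioo_mem_nhdsGT hl)
    have hrP : 𝓝[<] (1 : ℝ) ≤ 𝓟 (Ioo l 1) := le_principal_iff.2 (Ioo_mem_nhdsLT hl)
    exact isPreconnected_Ioo.intermediate_value_Iii hlP hrP hcont' hb ha (mem_univ 0)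
  choose! ut hmem hzero using hex
  have hlim : Tendsto ut atTop (𝓝[<] 1) := by
    refine (nhdsLT_basis (1 : ℝ)).tendsto_right_iff.2 fun x hx => ?_
    obtain ⟨u, hDu, hu⟩ := ((hone.eventually_lt_const hD₁).and
      (Ioo_mem_nhdsLT (max_lt hx hl))).exists
    have hu' : u ∈ Ioo l 1 := ⟨(le_max_right _ _).trans_lt hu.1, hu.2⟩
    have htend : Tendsto (fun t : ℝ => t * D u + c / (1 - u)) atTop atBot :=
      tendsto_atBot_add_const_right _ _ (tendsto_id.atTop_mul_const_of_neg hDu)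
    filter_upwards [eventually_gt_atTop 0, htend.eventually_lt_atBot 0] with t ht hneg
    refine ⟨((le_max_left _ _).trans_lt hu.1).trans ?_, (hmem t ht).2⟩
    refine ((hstrict t ht).lt_iff_lt hu' (hmem t ht)).1 ?_
    simpa only [hzero t ht] using hneg
  refine ⟨ut, fun t ht => ⟨hmem t ht, hzero t ht, fun u hu h => ?_⟩,
    hlim.mono_right nhdsWithin_le_nhds, ?_⟩
  · exact (hstrict t ht).injOn hu (hmem t ht) (h.trans (hzero t ht).symm)
  · have hD := hone.comp hlim
    refine (tendsto_const_nhds.div hD hD₁.ne).congr' ?_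
    filter_upwards [eventually_gt_atTop 0, hD.eventually_lt_const hD₁] with t ht hneg
    have h1 : (1 : ℝ) - ut t ≠ 0 := by linarith [(hmem t ht).2]
    have h2 := hzero t ht
    simp only [Function.comp_apply] at hneg
    field_simp at h2
    change -c / D (ut t) = t * (1 - ut t)
    rw [div_eq_iff hneg.ne]
    linarith

/-- The derivative `(p - 2 * k * u) / (2 * √q)` of the square root of the quadratic
`q = r + p * u - k * u ^ 2` is antitone where `q` is positive. -/
theorem deriv_sqrt_quadratic_le {k p r u w : ℝ} (hk : 0 ≤ k) (huw : u ≤ w)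
    (hu : 0 < r + p * u - k * u ^ 2) (hw : 0 < r + p * w - k * w ^ 2) :
    (p - 2 * k * w) / (2 * √(r + p * w - k * w ^ 2)) ≤
      (p - 2 * k * u) / (2 * √(r + p * u - k * u ^ 2)) := by
  have hsu := Real.sqrt_pos.2 hu
  have hsw := Real.sqrt_pos.2 hw
  have hAB : p - 2 * k * w ≤ p - 2 * k * u := by nlinarith
  rw [div_le_div_iff₀ (by positivity) (by positivity)]
  rcases le_total (p - 2 * k * w) 0 with hB | hB
  · rcases le_total 0 (p - 2 * k * u) with hA | hA
    · have h1 := mul_nonneg hA hsw.le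
      have h2 := mul_nonpos_of_nonpos_of_nonneg hB hsu.le
      nlinarith
    · have h : √(r + p * w - k * w ^ 2) ≤ √(r + p * u - k * u ^ 2) :=
        Real.sqrt_le_sqrt (by nlinarith)
      nlinarith
  · have h : √(r + p * u - k * u ^ 2) ≤ √(r + p * w - k * w ^ 2) :=
      Real.sqrt_le_sqrt (by nlinarith)
    nlinarith

/-- with |ρ| < 1, b > 0, χ(0) ≤ 0, χ(1) > 0 and Λ'₋(1) < 0, for every
t > 0 the time-dependent saddlepoint equation t·Λ'(u) + (2b/α)/(1−u) = 0 has a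
unique solution u_t ∈ (u₋, 1); moreover u_t → 1 and t(1 − u_t) → −2b/(αΛ'₋(1)). -/
theorem time_dependent_saddlepoint
    (a b α β ρ v : ℝ) (ha : 0 ≤ a) (hb : 0 < b) (hα : 0 < α) (hρ : |ρ| < 1) (hv : 0 < v)
    (χ γ Λ : ℝ → ℝ) (um : ℝ) (Λp1 : ℝ)
    (hχ : ∀ u, χ u = β + u * ρ * Real.sqrt α)
    (hγ : ∀ u, γ u = Real.sqrt (χ u ^ 2 + α * u * (1 - u)))
    (hΛ : ∀ u, Λ u = -(b / α) * (χ u + γ u) + (a / 2) * u * (u - 1))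
    (hum : um = (2 * β * ρ + Real.sqrt α
        - Real.sqrt ((2 * β * ρ + Real.sqrt α) ^ 2 + 4 * β ^ 2 * (1 - ρ ^ 2)))
        / (2 * Real.sqrt α * (1 - ρ ^ 2)))
    (hχ0 : χ 0 ≤ 0) (hχ1 : 0 < χ 1)
    (hΛp1 : Λp1 = -2 * b * ρ / Real.sqrt α + b / (2 * χ 1) + a / 2)
    (hΛp1neg : Λp1 < 0) :
    ∃ ut : ℝ → ℝ,
      (∀ t : ℝ, 0 < t →
        ut t ∈ Set.Ioo um 1 ∧
        t * deriv Λ (ut t) + (2 * b / α) / (1 - ut t) = 0 ∧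
        ∀ u ∈ Set.Ioo um 1, t * deriv Λ u + (2 * b / α) / (1 - u) = 0 → u = ut t) ∧
      Tendsto ut atTop (𝓝 1) ∧
      Tendsto (fun t => t * (1 - ut t)) atTop (𝓝 (-2 * b / (α * Λp1))) := by
  have hs : 0 < √α := Real.sqrt_pos.2 hα
  have hss : √α * √α = α := Real.mul_self_sqrt hα.le
  have hρ2 : 0 < 1 - ρ ^ 2 := by
    have := (sq_lt_one_iff_abs_lt_one ρ).2 hρ
    linarith
  obtain ⟨k, hk⟩ : ∃ k, k = α * (1 - ρ ^ 2) := ⟨_, rfl⟩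
  obtain ⟨p, hp⟩ : ∃ p, p = 2 * β * ρ * √α + α := ⟨_, rfl⟩
  have hk0 : 0 < k := by rw [hk]; positivity
  have hq : ∀ u, χ u ^ 2 + α * u * (1 - u) = β ^ 2 + p * u - k * u ^ 2 := by
    intro u
    rw [hχ, hp, hk]
    linear_combination (u ^ 2 * ρ ^ 2) * hss
  set d := (2 * β * ρ + √α) ^ 2 + 4 * β ^ 2 * (1 - ρ ^ 2) with hd
  have hd0 : 0 < d := by
    have hβ : 0 ≤ 4 * β ^ 2 * (1 - ρ ^ 2) := by positivity
    rcases eq_or_ne β 0 with h | h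
    · rw [hd, h]; simpa using pow_pos hs 2
    · have : 0 < 4 * β ^ 2 * (1 - ρ ^ 2) := by positivity
      nlinarith [sq_nonneg (2 * β * ρ + √α)]
  have hsd : 0 < √d := Real.sqrt_pos.2 hd0
  have hsd2 : √d * √d = d := Real.mul_self_sqrt hd0.le
  have hslope : p - 2 * k * um = √α * √d := by
    have h1 : um * (2 * √α * (1 - ρ ^ 2)) = 2 * β * ρ + √α - √d := by
      rw [hum]
      exact div_mul_cancel₀ _ (by positivity)
    rw [hp, hk]
    linear_combination -√α * h1 + (2 * um * (1 - ρ ^ 2) - 1) * hss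
  have hum0 : um ≤ 0 := by
    rw [hum]
    refine div_nonpos_of_nonpos_of_nonneg (sub_nonpos.2 (Real.le_sqrt_of_sq_le ?_)) (by positivity)
    rw [hd]
    nlinarith [mul_nonneg (sq_nonneg β) hρ2.le]
  have hqum : β ^ 2 + p * um - k * um ^ 2 = 0 := by
    have h1 : 4 * k * (β ^ 2 + p * um - k * um ^ 2) = 0 := by
      have h2 : (p - 2 * k * um) ^ 2 = α * d := by
        rw [hslope, mul_pow, pow_two, pow_two, hss, hsd2]
      have h3 : α * d = p ^ 2 + 4 * k * β ^ 2 := by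
        rw [hd, hp, hk]
        linear_combination (α - 4 * β ^ 2 * ρ ^ 2) * hss
      linarith
    have : 4 * k ≠ 0 := by positivity
    exact (mul_eq_zero.1 h1).resolve_left this
  have hq1 : β ^ 2 + p * 1 - k * 1 ^ 2 = χ 1 ^ 2 := by
    rw [← hq]; ring
  have hqpos : ∀ u ∈ Ioc um 1, 0 < β ^ 2 + p * u - k * u ^ 2 := by
    intro u hu
    have h1 : (1 - um) * (β ^ 2 + p * u - k * u ^ 2) =
        (u - um) * χ 1 ^ 2 + k * (1 - u) * (u - um) * (1 - um) := by
      rw [← hq1]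
      linear_combination (1 - u) * hqum
    have h2 : 0 < u - um := by linarith [hu.1]
    have h3 : 0 ≤ 1 - u := by linarith [hu.2]
    have h4 : 0 < 1 - um := by linarith
    refine pos_of_mul_pos_right (a := 1 - um) ?_ h4.le
    rw [h1]
    positivity
  obtain ⟨D, hD⟩ : ∃ D : ℝ → ℝ, D = fun u =>
      -(b / α) * (ρ * √α + (p - 2 * k * u) / (2 * √(β ^ 2 + p * u - k * u ^ 2)))
        + (a / 2) * (2 * u - 1) := ⟨_, rfl⟩
  have hderiv : ∀ u ∈ Ioo um 1, deriv Λ u = D u := by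
    intro u hu
    have hΛ' : Λ = fun u => -(b / α) * (β + u * (ρ * √α) + √(β ^ 2 + p * u - k * u ^ 2))
        + (a / 2) * (u * (u - 1)) := by
      funext x
      rw [hΛ, hγ, hq, hχ]
      ring
    have hx := hasDerivAt_id' u
    have h1 : HasDerivAt (fun x => β ^ 2 + p * x - k * x ^ 2) (p - 2 * k * u) u := by
      refine (((hx.const_mul p).const_add (β ^ 2)).sub ((hx.pow 2).const_mul k)).congr_deriv ?_
      simp
      ring
    rw [hΛ', hD]
    refine HasDerivAt.deriv ?_
    refine (((((hx.mul_const (ρ * √α)).const_add β).add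
      (h1.sqrt (hqpos u ⟨hu.1, hu.2.le⟩).ne')).const_mul (-(b / α))).add
      ((hx.mul (hx.sub_const 1)).const_mul (a / 2))).congr_deriv ?_
    ring
  have hDcont : ContinuousOn D (Ioc um 1) := by
    rw [hD]
    refine (continuousOn_const.mul (continuousOn_const.add
      (ContinuousOn.div (by fun_prop) (by fun_prop) ?_))).add (by fun_prop)
    intro u hu
    have := Real.sqrt_pos.2 (hqpos u hu)
    positivity
  have hDmono : MonotoneOn D (Ioo um 1) := by
    intro u hu w hw huw
    have h1 := deriv_sqrt_quadratic_le hk0.le huw (hqpos u ⟨hu.1, hu.2.le⟩)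
      (hqpos w ⟨hw.1, hw.2.le⟩)
    have h2 : 0 ≤ b / α := by positivity
    rw [hD]
    have h3 := mul_le_mul_of_nonneg_left h1 h2
    have h4 := mul_le_mul_of_nonneg_left huw ha
    simp only
    linarith
  have hum1 : um < 1 := by linarith
  have hD1 : D 1 = Λp1 := by
    rw [hD, hΛp1]
    simp only
    rw [hq1, Real.sqrt_sq hχ1.le]
    have h1 : p - 2 * k * 1 = 2 * χ 1 * (ρ * √α) - α := by
      rw [hχ, hp, hk]
      linear_combination (-2 * ρ ^ 2) * hss
    rw [h1]
    have h2 : ρ / √α = ρ * √α / α := by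
      rw [div_eq_div_iff hs.ne' hα.ne']
      linear_combination -ρ * hss
    have h3 : -2 * b * ρ / √α = -2 * b * (ρ * √α / α) := by rw [← h2]; ring
    rw [h3]
    field_simp
    ring
  have hDone : Tendsto D (𝓝[<] 1) (𝓝 Λp1) := by
    rw [← hD1, ← nhdsWithin_Ioo_eq_nhdsLT hum1]
    exact (hDcont 1 ⟨hum1, le_rfl⟩).mono_left (nhdsWithin_mono _ Ioo_subset_Ioc_self)
  have hDbot : Tendsto D (𝓝[>] um) atBot := by
    have hnum : Tendsto (fun u => p - 2 * k * u) (𝓝[>] um) (𝓝 (√α * √d)) := by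
      rw [← hslope]
      exact (Continuous.tendsto (by fun_prop) um).mono_left nhdsWithin_le_nhds
    have hden : Tendsto (fun u => 2 * √(β ^ 2 + p * u - k * u ^ 2)) (𝓝[>] um) (𝓝[>] 0) := by
      refine tendsto_nhdsWithin_iff.2 ⟨?_, ?_⟩
      · have h : Continuous (fun u => 2 * √(β ^ 2 + p * u - k * u ^ 2)) := by fun_prop
        have h' := (h.tendsto um).mono_left (nhdsWithin_le_nhds (s := Ioi um))
        simpa only [hqum, Real.sqrt_zero, mul_zero] using h'
      · filter_upwards [Ioo_mem_nhdsGT hum1] with u hu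
        have := Real.sqrt_pos.2 (hqpos u ⟨hu.1, hu.2.le⟩)
        exact mem_Ioi.2 (by positivity)
    have hquot : Tendsto (fun u => (p - 2 * k * u) / (2 * √(β ^ 2 + p * u - k * u ^ 2)))
        (𝓝[>] um) atTop :=
      hnum.pos_mul_atTop (by positivity) hden.inv_tendsto_nhdsGT_zero
    have hlin : Tendsto (fun u => (a / 2) * (2 * u - 1)) (𝓝[>] um) (𝓝 ((a / 2) * (2 * um - 1))) :=
      (Continuous.tendsto (by fun_prop) um).mono_left nhdsWithin_le_nhds
    have hneg : -(b / α) < 0 := neg_neg_of_pos (by positivity)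
    rw [hD]
    exact ((tendsto_atTop_add_const_left _ (ρ * √α) hquot).const_mul_atTop_of_neg hneg).atBot_add
      hlin
  have hev : ∀ {F : Filter ℝ}, Ioo um 1 ∈ F → D =ᶠ[F] deriv Λ := fun hF => by
    filter_upwards [hF] with u hu using (hderiv u hu).symm
  have hlimit : -2 * b / (α * Λp1) = -(2 * b / α) / Λp1 := by
    field_simp
  rw [hlimit]
  exact exists_unique_saddlepoint_of_monotoneOn hum1 (by positivity)
    ((hDcont.mono Ioo_subset_Ioc_self).congr hderiv)
    (hDmono.congr fun u hu => (hderiv u hu).symm)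
    (hDbot.congr' (hev (Ioo_mem_nhdsGT hum1))) (hDone.congr' (hev (Ioo_mem_nhdsLT hum1))) hΛp1neg
end

section
/- Fix Σ > 0 and x ∈ ℝ, and for t > 0 let μ_t denote the Gaussian measure on ℝ with mean −Σ²t/2 and variance Σ²t (the law of the Black–Scholes log-price at time t). Then the large-maturity put price satisfies: lim_{t→∞} (1/t)·log ∫_ℝ max(e^{x·t} − e^{y}, 0) dμ_t(y) = x − (x + Σ²/2)²/(2Σ²) if x ≤ −Σ²/2, and the limit equals x if x > −Σ²/2. -/
open Real Set Filter Topology MeasureTheory ProbabilityTheory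

lemma integrable_put_payoff (k : ℝ) (μ : Measure ℝ) [IsFiniteMeasure μ] :
    Integrable (fun y : ℝ => max (Real.exp k - Real.exp y) 0) μ := by
  refine Integrable.of_bound (C := Real.exp k) (by fun_prop) (ae_of_all _ fun y => ?_)
  rw [Real.norm_of_nonneg (le_max_right _ _)]
  exact max_le (by linarith [Real.exp_pos y]) (Real.exp_pos k).le

/-- Chernoff-type upper bound for a put price under a Gaussian log-price. -/
lemma integral_put_payoff_gaussianReal_le (k m p : ℝ) (v : NNReal) (hp : 0 ≤ p) :
    ∫ y : ℝ, max (Real.exp k - Real.exp y) 0 ∂(gaussianReal m v) ≤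
      Real.exp (k + p * (k - m) + v * p ^ 2 / 2) := by
  have hmgf : ∫ y, Real.exp (-p * y) ∂(gaussianReal m v) =
      Real.exp (m * (-p) + v * (-p) ^ 2 / 2) :=
    congrFun (mgf_id_gaussianReal (μ := m) (v := v)) (-p)
  have hle : ∫ y : ℝ, max (Real.exp k - Real.exp y) 0 ∂(gaussianReal m v) ≤
      ∫ y, Real.exp (k + p * k) * Real.exp (-p * y) ∂(gaussianReal m v) := by
    refine integral_mono (integrable_put_payoff k _)
      ((integrable_exp_mul_gaussianReal (-p)).const_mul _) fun y => ?_
    refine max_le ?_ (by positivity)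
    rw [← Real.exp_add]
    rcases le_total y k with h | h
    · have : k ≤ k + p * k + -p * y := by nlinarith
      linarith [Real.exp_le_exp.2 this, Real.exp_pos y]
    · linarith [Real.exp_le_exp.2 h, Real.exp_pos (k + p * k + -p * y)]
  rw [integral_const_mul, hmgf, ← Real.exp_add] at hle
  exact hle.trans_eq (by ring_nf)

/-- Lower bound for a put price by the Gaussian mass of a unit interval below the log-strike. -/
lemma le_integral_put_payoff_gaussianReal (k l m : ℝ) (v : NNReal) (hv : v ≠ 0) (hl : l ≤ k) :
    Real.exp k / 2 * ((√(2 * π * v))⁻¹ *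
        Real.exp (-((l - m) ^ 2 + 4 * |l - m| + 4) / (2 * v))) ≤
      ∫ y : ℝ, max (Real.exp k - Real.exp y) 0 ∂(gaussianReal m v) := by
  have hv' : (0 : ℝ) < v := by positivity
  have hpdf : ∀ y ∈ Icc (l - 2) (l - 1), (√(2 * π * v))⁻¹ *
      Real.exp (-((l - m) ^ 2 + 4 * |l - m| + 4) / (2 * v)) ≤ gaussianPDFReal m v y := by
    intro y hy
    rw [gaussianPDFReal_def]
    dsimp only
    gcongr
    obtain ⟨h1, h2⟩ := hy
    nlinarith [neg_abs_le (l - m), le_abs_self (l - m), abs_nonneg (l - m)]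
  have hmass : (√(2 * π * v))⁻¹ * Real.exp (-((l - m) ^ 2 + 4 * |l - m| + 4) / (2 * v)) ≤
      (gaussianReal m v).real (Icc (l - 2) (l - 1)) := by
    rw [Measure.real, gaussianReal_apply_eq_integral m hv, ENNReal.toReal_ofReal
      (integral_nonneg fun y => gaussianPDFReal_nonneg m v y)]
    have := setIntegral_mono_on (μ := volume) (s := Icc (l - 2) (l - 1))
      (integrableOn_const (by simp)) (integrable_gaussianPDFReal m v).integrableOn
      measurableSet_Icc hpdf
    simpa [show l - 1 - (l - 2) = 1 by ring] using this
  calc _ ≤ Real.exp k / 2 * (gaussianReal m v).real (Icc (l - 2) (l - 1)) := by gcongr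
    _ = ∫ y in Icc (l - 2) (l - 1), Real.exp k / 2 ∂(gaussianReal m v) := by
      simp [mul_comm]
    _ ≤ ∫ y in Icc (l - 2) (l - 1), max (Real.exp k - Real.exp y) 0 ∂(gaussianReal m v) := by
      refine setIntegral_mono_on (integrableOn_const (by simp))
        (integrable_put_payoff k _).integrableOn measurableSet_Icc fun y hy => ?_
      refine le_max_of_le_left ?_
      have h1 : Real.exp (y + 1) ≤ Real.exp k := Real.exp_le_exp.2 (by linarith [hy.2])
      rw [Real.exp_add] at h1
      nlinarith [Real.add_one_le_exp (1 : ℝ), Real.exp_pos y]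
    _ ≤ _ := setIntegral_le_integral (integrable_put_payoff k _)
      (ae_of_all _ fun y => le_max_right _ _)

/-- The put price decays at the rate given by the Chernoff bound with parameter `p`, as soon as
this rate is attained at a log-strike rate `c` below `x`. -/
lemma tendsto_log_black_scholes_put (σ : ℝ) (hσ : 0 < σ) (x c p L : ℝ) (hc : c ≤ x) (hp : 0 ≤ p)
    (hU : x + p * (x + σ ^ 2 / 2) + σ ^ 2 * p ^ 2 / 2 = L)
    (hL : x - (c + σ ^ 2 / 2) ^ 2 / (2 * σ ^ 2) = L) :
    Tendsto (fun t : ℝ =>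
        (1 / t) * Real.log (∫ y : ℝ, max (Real.exp (x * t) - Real.exp y) 0
          ∂(gaussianReal (-σ ^ 2 * t / 2) (Real.toNNReal (σ ^ 2 * t)))))
      atTop (𝓝 L) := by
  set A := c + σ ^ 2 / 2 with hA
  set K := Real.log 2 + Real.log (2 * π * σ ^ 2) / 2 + (2 * |A| + 2) / σ ^ 2 with hK
  have hlim : Tendsto (fun t : ℝ => L - (K * t⁻¹ + Real.log t / t / 2)) atTop (𝓝 L) := by
    have h1 : Tendsto (fun t : ℝ => Real.log t / t) atTop (𝓝 0) :=
      Real.isLittleO_log_id_atTop.tendsto_div_nhds_zero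
    simpa using ((tendsto_inv_atTop_zero.const_mul K).add (h1.div_const 2)).const_sub L
  refine tendsto_of_tendsto_of_tendsto_of_le_of_le' hlim tendsto_const_nhds ?_ ?_
  all_goals
    filter_upwards [eventually_ge_atTop 1] with t ht
    have ht0 : 0 < t := by linarith
    have hvt : ((Real.toNNReal (σ ^ 2 * t) : NNReal) : ℝ) = σ ^ 2 * t :=
      Real.coe_toNNReal _ (by positivity)
    have hv : Real.toNNReal (σ ^ 2 * t) ≠ 0 := by
      rw [← NNReal.coe_ne_zero, hvt]; positivity
    have hlow := le_integral_put_payoff_gaussianReal (x * t) (c * t) (-σ ^ 2 * t / 2) _ hv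
      (by gcongr)
    have hup := integral_put_payoff_gaussianReal_le (x * t) (-σ ^ 2 * t / 2) p
      (Real.toNNReal (σ ^ 2 * t)) hp
    rw [hvt] at hlow hup
    set P := ∫ y : ℝ, max (Real.exp (x * t) - Real.exp y) 0
      ∂(gaussianReal (-σ ^ 2 * t / 2) (Real.toNNReal (σ ^ 2 * t)))
    have hpos : 0 < P := lt_of_lt_of_le (by positivity) hlow
    rw [one_div_mul_eq_div]
  · rw [le_div_iff₀ ht0]
    have h := Real.log_le_log (by positivity) hlow
    have hAt : c * t - -σ ^ 2 * t / 2 = A * t := by rw [hA]; ring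
    rw [Real.log_mul (by positivity) (by positivity), Real.log_mul (by positivity) (by positivity),
      Real.log_div (by positivity) (by positivity), Real.log_exp, Real.log_exp, Real.log_inv,
      Real.log_sqrt (by positivity), ← mul_assoc, Real.log_mul (by positivity) ht0.ne', hAt,
      abs_mul, abs_of_pos ht0] at h
    have hexp : -(A ^ 2 / (2 * σ ^ 2)) * t - (2 * |A| + 2) / σ ^ 2 ≤
        -((A * t) ^ 2 + 4 * (|A| * t) + 4) / (2 * (σ ^ 2 * t)) := by
      have h2 : -((A * t) ^ 2 + 4 * (|A| * t) + 4) / (2 * (σ ^ 2 * t)) =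
          -(A ^ 2 / (2 * σ ^ 2)) * t - (2 * |A| + 2 / t) / σ ^ 2 := by
        field_simp
        ring
      rw [h2]
      have h3 : 2 / t ≤ 2 := div_le_self (by norm_num) ht
      gcongr
    have hrw : (L - (K * t⁻¹ + Real.log t / t / 2)) * t = L * t - K - Real.log t / 2 := by
      field_simp
      ring
    rw [hrw, hK, ← hL]
    linarith
  · rw [div_le_iff₀ ht0, Real.log_le_iff_le_exp hpos, ← hU]
    exact hup.trans_eq (by ring_nf)

/-- large-maturity Black–Scholes put price asymptotics:
(1/t)·log E[(e^{xt} − e^{X_t})₊] → x − Λ*_BS(x,Σ) if x ≤ −Σ²/2 and → x otherwise,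
where the Black–Scholes log-price X_t ~ N(−Σ²t/2, Σ²t). -/
theorem black_scholes_put_asymptotics
    (σ : ℝ) (hσ : 0 < σ) (x : ℝ) :
    (x ≤ -σ ^ 2 / 2 →
      Tendsto (fun t : ℝ =>
          (1 / t) * Real.log (∫ y : ℝ, max (Real.exp (x * t) - Real.exp y) 0
            ∂(gaussianReal (-σ ^ 2 * t / 2) (Real.toNNReal (σ ^ 2 * t)))))
        atTop (𝓝 (x - (x + σ ^ 2 / 2) ^ 2 / (2 * σ ^ 2)))) ∧
    (-σ ^ 2 / 2 < x →
      Tendsto (fun t : ℝ =>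
          (1 / t) * Real.log (∫ y : ℝ, max (Real.exp (x * t) - Real.exp y) 0
            ∂(gaussianReal (-σ ^ 2 * t / 2) (Real.toNNReal (σ ^ 2 * t)))))
        atTop (𝓝 x)) := by
  refine ⟨fun hx => ?_, fun hx => ?_⟩
  · refine tendsto_log_black_scholes_put σ hσ x x (-(x + σ ^ 2 / 2) / σ ^ 2) _ le_rfl
      (div_nonneg (by linarith) (by positivity)) ?_ rfl
    field_simp
    ring
  · refine tendsto_log_black_scholes_put σ hσ x (-σ ^ 2 / 2) 0 x hx.le le_rfl (by ring) ?_
    ring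
end

section
/- Fix Σ > 0 and x ∈ ℝ, and for t > 0 let μ_t denote the Gaussian measure on ℝ with mean −Σ²t/2 and variance Σ²t (the law of the Black–Scholes log-price at time t). Then the large-maturity call price satisfies: lim_{t→∞} (1/t)·log ∫_ℝ max(e^{y} − e^{x·t}, 0) dμ_t(y) = x − (x + Σ²/2)²/(2Σ²) if x ≥ Σ²/2, and the limit equals 0 if x < Σ²/2. -/
open Real Set Filter Topology MeasureTheory ProbabilityTheory

open scoped NNReal

lemma call_payoff_le_exp {k u : ℝ} (hu : 1 ≤ u) (y : ℝ) :
    max (exp y - exp k) 0 ≤ exp (u * y - (u - 1) * k) := by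
  refine max_le ?_ (exp_pos _).le
  rcases le_total y k with h | h
  · have := exp_le_exp.2 h
    linarith [exp_pos (u * y - (u - 1) * k)]
  · have : exp y ≤ exp (u * y - (u - 1) * k) :=
      exp_le_exp.2 (by nlinarith [mul_nonneg (sub_nonneg.2 hu) (sub_nonneg.2 h)])
    linarith [exp_pos k]

lemma integrable_call_payoff_gaussianReal (m : ℝ) (v : ℝ≥0) (k : ℝ) :
    Integrable (fun y => max (exp y - exp k) 0) (gaussianReal m v) := by
  have h : Integrable (fun y => exp y) (gaussianReal m v) := by
    simpa using integrable_exp_mul_gaussianReal (μ := m) (v := v) 1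
  exact (h.sub (integrable_const _)).pos_part

lemma integral_call_payoff_gaussianReal_le (m : ℝ) (v : ℝ≥0) (k : ℝ) {u : ℝ} (hu : 1 ≤ u) :
    ∫ y, max (exp y - exp k) 0 ∂(gaussianReal m v)
      ≤ exp (m * u + v * u ^ 2 / 2 - (u - 1) * k) := by
  have hmgf : ∫ y, exp (u * y) ∂(gaussianReal m v) = exp (m * u + v * u ^ 2 / 2) :=
    congrFun (mgf_id_gaussianReal (μ := m) (v := v)) u
  calc ∫ y, max (exp y - exp k) 0 ∂(gaussianReal m v)
      ≤ ∫ y, exp (u * y) * exp (-((u - 1) * k)) ∂(gaussianReal m v) := by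
        refine integral_mono (integrable_call_payoff_gaussianReal m v k)
          ((integrable_exp_mul_gaussianReal u).mul_const _) fun y => ?_
        simpa only [← exp_add, ← sub_eq_add_neg] using call_payoff_le_exp hu y
    _ = exp (m * u + v * u ^ 2 / 2 - (u - 1) * k) := by
        rw [integral_mul_const, hmgf, ← exp_add, ← sub_eq_add_neg]

lemma gaussianPDFReal_le_measureReal_Icc {m b : ℝ} {v : ℝ≥0} (hv : v ≠ 0) (hb : m ≤ b) :
    gaussianPDFReal m v (b + 1) ≤ (gaussianReal m v).real (Icc b (b + 1)) := by
  rw [measureReal_def, gaussianReal_apply_eq_integral m hv, ENNReal.toReal_ofReal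
    (integral_nonneg fun y => gaussianPDFReal_nonneg m v y)]
  have h := setIntegral_mono_on (μ := volume) (s := Icc b (b + 1))
    (f := fun _ => gaussianPDFReal m v (b + 1)) (g := gaussianPDFReal m v)
    (integrableOn_const (by simp)) (integrable_gaussianPDFReal m v).integrableOn
    measurableSet_Icc fun y hy => by
      simp only [gaussianPDFReal]
      have hy0 : 0 ≤ y - m := by linarith [hy.1]
      have hy1 : y - m ≤ b + 1 - m := by linarith [hy.2]
      gcongr
  simpa using h

lemma le_integral_call_payoff_gaussianReal {m k b : ℝ} {v : ℝ≥0} (hv : v ≠ 0) (hk : k ≤ b)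
    (hb : m ≤ b + 1) :
    exp b * gaussianPDFReal m v (b + 2)
      ≤ ∫ y, max (exp y - exp k) 0 ∂(gaussianReal m v) := by
  have hsub : Icc (b + 1) (b + 1 + 1) ⊆ {y | exp b ≤ max (exp y - exp k) 0} := by
    intro y hy
    have h1 : exp (b + 1) ≤ exp y := exp_le_exp.2 hy.1
    have h2 : exp k ≤ exp b := exp_le_exp.2 hk
    have h3 : 2 * exp b ≤ exp (b + 1) := by
      rw [exp_add, mul_comm]
      gcongr
      linarith [add_one_le_exp (1 : ℝ)]
    have h4 : exp b ≤ exp y - exp k := by linarith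
    exact le_max_of_le_left h4
  calc exp b * gaussianPDFReal m v (b + 2)
      ≤ exp b * (gaussianReal m v).real {y | exp b ≤ max (exp y - exp k) 0} := by
        gcongr
        have h := gaussianPDFReal_le_measureReal_Icc hv hb
        rw [show b + 1 + 1 = b + 2 by ring] at h hsub
        exact h.trans (measureReal_mono hsub)
    _ ≤ _ := mul_meas_ge_le_integral_of_nonneg (ae_of_all _ fun y => le_max_right _ _)
        (integrable_call_payoff_gaussianReal m v k) _

lemma log_gaussianPDFReal (m : ℝ) {v : ℝ≥0} (hv : v ≠ 0) (y : ℝ) :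
    log (gaussianPDFReal m v y) = -(log (2 * π * v) / 2) - (y - m) ^ 2 / (2 * v) := by
  have hv' : (0 : ℝ) < v := by exact_mod_cast pos_iff_ne_zero.2 hv
  rw [gaussianPDFReal, log_mul (by positivity) (exp_pos _).ne', log_inv, log_exp,
    log_sqrt (by positivity)]
  ring

/-- The rate of the large-maturity call price, expressed through `a = max x (σ² / 2)`. -/
lemma tendsto_log_call_price_div {σ x a : ℝ} (hσ : 0 < σ) (hxa : x ≤ a) (hσa : σ ^ 2 / 2 ≤ a)
    (ha : (a - σ ^ 2 / 2) * (a - x) = 0) :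
    Tendsto (fun t : ℝ =>
        (1 / t) * Real.log (∫ y : ℝ, max (Real.exp y - Real.exp (x * t)) 0
          ∂(gaussianReal (-σ ^ 2 * t / 2) (Real.toNNReal (σ ^ 2 * t)))))
      atTop (𝓝 (a - (a + σ ^ 2 / 2) ^ 2 / (2 * σ ^ 2))) := by
  have hs : 0 < σ ^ 2 := by positivity
  set s := σ ^ 2
  have hinv : Tendsto (fun t : ℝ => 1 / t) atTop (𝓝 0) := by
    simpa using tendsto_inv_atTop_zero (𝕜 := ℝ)
  have hlog : Tendsto (fun t : ℝ => log (2 * π * (s * t)) / t) atTop (𝓝 0) := by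
    have hc : (0 : ℝ) < 2 * π * s := by positivity
    have h := (isLittleO_log_id_atTop.tendsto_div_nhds_zero.comp
      (tendsto_id.const_mul_atTop hc)).const_mul (2 * π * s)
    rw [mul_zero] at h
    refine h.congr' ?_
    filter_upwards [eventually_gt_atTop 0] with t ht
    simp only [Function.comp_apply, id]
    rw [← mul_assoc (2 * π)]
    field_simp
  have hlower : Tendsto (fun t : ℝ => a - log (2 * π * (s * t)) / t / 2
      - (a + s / 2 + 2 * (1 / t)) ^ 2 / (2 * s)) atTop (𝓝 (a - (a + s / 2) ^ 2 / (2 * s))) := by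
    have h := (hlog.div_const 2).const_sub a |>.sub
      ((((hinv.const_mul 2).const_add (a + s / 2)).pow 2).div_const (2 * s))
    simpa using h
  refine tendsto_of_tendsto_of_tendsto_of_le_of_le' hlower tendsto_const_nhds ?_ ?_
  all_goals
    filter_upwards [eventually_gt_atTop 0] with t ht
    have hst : 0 < s * t := mul_pos hs ht
    have hv : (s * t).toNNReal ≠ 0 := by simpa using hst
    have hvcoe : ((s * t).toNNReal : ℝ) = s * t := Real.coe_toNNReal _ hst.le
    have hprice := le_integral_call_payoff_gaussianReal (m := -s * t / 2) (k := x * t) hv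
      (b := a * t) (by gcongr) (by nlinarith)
    have hpdf := gaussianPDFReal_pos (-s * t / 2) _ (a * t + 2) hv
    have hpos := mul_pos (exp_pos (a * t)) hpdf
  · have h := log_le_log hpos hprice
    rw [log_mul (exp_pos _).ne' hpdf.ne', log_exp, log_gaussianPDFReal _ hv, hvcoe] at h
    refine le_trans (le_of_eq ?_) (mul_le_mul_of_nonneg_left h (one_div_pos.2 ht).le)
    field_simp
    ring
  · have hu : 1 ≤ a / s + 1 / 2 := by
      have : 1 / 2 ≤ a / s := by rw [le_div_iff₀ hs]; linarith
      linarith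
    have h := log_le_log (hpos.trans_le hprice)
      (integral_call_payoff_gaussianReal_le (-s * t / 2) (s * t).toNNReal (x * t) hu)
    rw [log_exp, hvcoe] at h
    refine (mul_le_mul_of_nonneg_left h (one_div_pos.2 ht).le).trans (le_of_eq ?_)
    field_simp
    linear_combination 8 * ha

/-- large-maturity Black–Scholes call price asymptotics:
(1/t)·log E[(e^{X_t} − e^{xt})₊] → x − Λ*_BS(x,Σ) if x ≥ Σ²/2 and → 0 otherwise,
where the Black–Scholes log-price X_t ~ N(−Σ²t/2, Σ²t). -/
theorem black_scholes_call_asymptotics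
    (σ : ℝ) (hσ : 0 < σ) (x : ℝ) :
    (σ ^ 2 / 2 ≤ x →
      Tendsto (fun t : ℝ =>
          (1 / t) * Real.log (∫ y : ℝ, max (Real.exp y - Real.exp (x * t)) 0
            ∂(gaussianReal (-σ ^ 2 * t / 2) (Real.toNNReal (σ ^ 2 * t)))))
        atTop (𝓝 (x - (x + σ ^ 2 / 2) ^ 2 / (2 * σ ^ 2)))) ∧
    (x < σ ^ 2 / 2 →
      Tendsto (fun t : ℝ =>
          (1 / t) * Real.log (∫ y : ℝ, max (Real.exp y - Real.exp (x * t)) 0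
            ∂(gaussianReal (-σ ^ 2 * t / 2) (Real.toNNReal (σ ^ 2 * t)))))
        atTop (𝓝 0)) := by
  refine ⟨fun hx => ?_, fun hx => ?_⟩
  · exact tendsto_log_call_price_div hσ le_rfl hx (by ring)
  · have h := tendsto_log_call_price_div hσ hx.le le_rfl (by ring)
    convert h using 2
    field_simp
    ring
end
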